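/- arXiv:2110.13186 — 9 statements merged into one kernel-verified Lean document; each statement's English description precedes it below -/
import Mathlib

section
/- Let K be a field, A a K-algebra, a a unit of A, and φ an involution on A. If φ(a) = a or φ(a) = −a, then Ψ_a ∘ φ is an involution on A. Conversely, if A is a central K-algebra (its center is K·1) and Ψ_a ∘ φ is an involution on A, then φ(a) = a or φ(a) = −a. -/
/-- Let `K` be a field, `A` a `K`-algebra, `a` a unit of `A` and `φ` an involution on `A`.
If `φ(a) = a` or `φ(a) = -a`, then `Ψ_a ∘ φ` is an involution on `A` (being already an
anti-automorphism, it suffices that it has order two).  Conversely, if `A` is a central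
`K`-algebra (its center is `K·1`, i.e. the range of `algebraMap K A`) and `Ψ_a ∘ φ` is an
involution on `A`, then `φ(a) = a` or `φ(a) = -a`. -/
theorem inner_comp_involution_isInvolution_iff_symm_or_skew
    (K A : Type*) [Field K] [Ring A] [Algebra K A]
    (a : Aˣ) (φ : A → A)
    (hadd : ∀ x y : A, φ (x + y) = φ x + φ y)
    (hsmul : ∀ (k : K) (x : A), φ (k • x) = k • φ x)
    (hanti : ∀ x y : A, φ (x * y) = φ y * φ x)
    (hbij : Function.Bijective φ)
    (hinv : ∀ x : A, φ (φ x) = x) :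
    ((φ ↑a = ↑a ∨ φ ↑a = -↑a) → ∀ x : A, ↑a * φ (↑a * φ x * ↑a⁻¹) * ↑a⁻¹ = x) ∧
    (Set.center A = Set.range (algebraMap K A) →
      (∀ x : A, ↑a * φ (↑a * φ x * ↑a⁻¹) * ↑a⁻¹ = x) →
      (φ ↑a = ↑a ∨ φ ↑a = -↑a)) := by
  have h1 : φ 1 = 1 := by
    have h := hanti (φ 1) 1
    rwa [mul_one, hinv, mul_one, eq_comm] at h
  have huv : φ ↑a * φ ↑a⁻¹ = 1 := by rw [← hanti, Units.inv_mul, h1]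
  have hcomp : ∀ x : A, ↑a * φ (↑a * φ x * ↑a⁻¹) * ↑a⁻¹
      = (↑a * φ ↑a⁻¹) * x * (φ ↑a * ↑a⁻¹) := by
    intro x
    rw [hanti, hanti, hinv]
    simp only [mul_assoc]
  refine ⟨fun h x => ?_, fun hcenter h => ?_⟩
  · rw [hcomp]
    rcases h with h | h
    · have hv : ↑a * φ ↑a⁻¹ = 1 := by rwa [h] at huv
      rw [h, hv, Units.mul_inv, one_mul, mul_one]
    · have hv : ↑a * φ ↑a⁻¹ = -1 := by
        rw [h, neg_mul] at huv
        rw [← huv, neg_neg]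
      rw [h, hv, neg_one_mul, neg_mul (a : A), neg_mul_neg, Units.mul_inv, mul_one]
  · have hz : φ ↑a * ↑a⁻¹ ∈ Set.center A := by
      rw [Semigroup.mem_center_iff]
      intro x
      have hx := h x
      rw [hcomp] at hx
      have hinvz : (φ ↑a * ↑a⁻¹) * (↑a * φ ↑a⁻¹) = 1 := by
        rw [mul_assoc, Units.inv_mul_cancel_left, huv]
      calc x * (φ ↑a * ↑a⁻¹)
          = (φ ↑a * ↑a⁻¹) * (↑a * φ ↑a⁻¹) * x * (φ ↑a * ↑a⁻¹) := by rw [hinvz, one_mul]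
        _ = (φ ↑a * ↑a⁻¹) * ((↑a * φ ↑a⁻¹) * x * (φ ↑a * ↑a⁻¹)) := by simp only [mul_assoc]
        _ = (φ ↑a * ↑a⁻¹) * x := by rw [hx]
    rw [hcenter] at hz
    obtain ⟨k, hk⟩ := hz
    have ha : φ ↑a = k • (↑a : A) := by
      rw [Algebra.smul_def, hk, Units.inv_mul_cancel_right]
    rcases subsingleton_or_nontrivial A with hA | hA
    · exact Or.inl (Subsingleton.elim _ _)
    · have hkk : (k * k) • (↑a : A) = (1 : K) • (↑a : A) := by
        rw [mul_smul, ← ha, ← hsmul, ← ha, hinv, one_smul]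
      rcases mul_self_eq_one_iff.mp (smul_left_injective K a.ne_zero hkk) with rfl | rfl
      · exact Or.inl (by rw [ha, one_smul])
      · exact Or.inr (by rw [ha, neg_one_smul])
end

section
/- If the poset X is connected, then the center of D(X,K) equals {(k₁δ, k₂δ) : k₁, k₂ ∈ K}. -/
open TrivSqZeroExt

namespace IncidenceAlgebra

variable {K X : Type*} [PartialOrder X] [DecidableEq X]

/-- The matrix unit of the incidence algebra attached to a comparability `a ≤ b`. -/
def single (K : Type*) [Zero K] [One K] {a b : X} (hab : a ≤ b) : IncidenceAlgebra K X where
  toFun x y := if x = a ∧ y = b then 1 else 0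
  eq_zero_of_not_le' x y hxy := if_neg fun h : x = a ∧ y = b ↦ hxy (h.1 ▸ h.2 ▸ hab)

lemma single_apply [Zero K] [One K] {a b : X} (hab : a ≤ b) (x y : X) :
    single K hab x y = if x = a ∧ y = b then 1 else 0 := rfl

variable [LocallyFiniteOrder X]

lemma mul_single_apply_right [NonAssocSemiring K] (f : IncidenceAlgebra K X) {a b : X}
    (hab : a ≤ b) (x : X) : (f * single K hab) x b = f x a := by
  by_cases hxa : x ≤ a
  · simp [single_apply, hxa, hab]
  · simp [single_apply, hxa, apply_eq_zero_of_not_le hxa]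

lemma mul_single_apply_of_ne [NonAssocSemiring K] (f : IncidenceAlgebra K X) {a b : X}
    (hab : a ≤ b) (x : X) {y : X} (hy : y ≠ b) : (f * single K hab) x y = 0 := by
  simp [single_apply, hy]

lemma single_mul_apply_left [NonAssocSemiring K] (f : IncidenceAlgebra K X) {a b : X}
    (hab : a ≤ b) (y : X) : (single K hab * f) a y = f b y := by
  by_cases hby : b ≤ y
  · simp [single_apply, hby, hab]
  · simp [single_apply, hby, apply_eq_zero_of_not_le hby]

/-- A central element of the incidence algebra of a connected poset is a scalar multiple
of the identity. -/
lemma exists_eq_smul_one_of_commute [NonAssocSemiring K]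
    (hconn : ∀ x y : X, Relation.ReflTransGen (fun a b : X => a ≤ b ∨ b ≤ a) x y)
    {f : IncidenceAlgebra K X} (hf : ∀ g, f * g = g * f) :
    ∃ k : K, f = k • (1 : IncidenceAlgebra K X) := by
  rcases isEmpty_or_nonempty X with _ | ⟨⟨o⟩⟩
  · exact ⟨0, by ext a; exact isEmptyElim a⟩
  have off_diag : ∀ a b, a ≠ b → f a b = 0 := fun a b hab ↦ by
    rw [← single_mul_apply_left f (le_refl a) b, ← hf,
      mul_single_apply_of_ne f (le_refl a) a hab.symm]
  have diag_of_le : ∀ a b, a ≤ b → f a a = f b b := fun a b hab ↦ by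
    rw [← mul_single_apply_right f hab a, hf, single_mul_apply_left]
  have diag : ∀ x, f o o = f x x := fun x ↦ by
    induction hconn o x with
    | refl => rfl
    | tail _ h ih => exact ih.trans (h.elim (diag_of_le _ _) fun h ↦ (diag_of_le _ _ h).symm)
  refine ⟨f o o, ?_⟩
  ext a b
  rw [constSMul_apply, one_apply]
  split_ifs with hab
  · rw [← hab, ← diag a, smul_eq_mul, mul_one]
  · rw [off_diag a b hab, smul_zero]

end IncidenceAlgebra

/-- If the (locally finite) poset `X` is connected — any two elements are joined by a finite
sequence of comparabilities — then the center of the idealization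
`D(X,K) = I(X,K)(+)I(X,K)` equals `{(k₁δ, k₂δ) : k₁, k₂ ∈ K}`, where `δ` is the identity
of the incidence algebra `I(X,K)`. -/
theorem center_of_D_of_connected
    (K X : Type*) [Field K] [PartialOrder X] [LocallyFiniteOrder X] [DecidableEq X]
    (hconn : ∀ x y : X, Relation.ReflTransGen (fun a b : X => a ≤ b ∨ b ≤ a) x y) :
    Set.center (TrivSqZeroExt (IncidenceAlgebra K X) (IncidenceAlgebra K X)) =
      {d : TrivSqZeroExt (IncidenceAlgebra K X) (IncidenceAlgebra K X) |
        ∃ k₁ k₂ : K,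
          d = inl (k₁ • (1 : IncidenceAlgebra K X)) +
              inr (k₂ • (1 : IncidenceAlgebra K X))} := by
  have fst_mul' (x y : TrivSqZeroExt (IncidenceAlgebra K X) (IncidenceAlgebra K X)) :
      (x * y).fst = x.fst * y.fst := rfl
  have snd_mul' (x y : TrivSqZeroExt (IncidenceAlgebra K X) (IncidenceAlgebra K X)) :
      (x * y).snd = x.fst * y.snd + x.snd * y.fst := rfl
  ext d
  constructor
  · intro hd
    have hfst : ∀ g, d.fst * g = g * d.fst := fun g ↦ by
      simpa using congrArg snd (hd.comm (inr g)).eq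
    have hsnd : ∀ g, d.snd * g = g * d.snd := fun g ↦ by
      simpa using congrArg snd (hd.comm (inl g)).eq
    obtain ⟨k₁, h₁⟩ := IncidenceAlgebra.exists_eq_smul_one_of_commute hconn hfst
    obtain ⟨k₂, h₂⟩ := IncidenceAlgebra.exists_eq_smul_one_of_commute hconn hsnd
    exact ⟨k₁, k₂, by rw [← h₁, ← h₂, inl_fst_add_inr_snd_eq]⟩
  · rintro ⟨k₁, k₂, rfl⟩
    refine ⟨fun y ↦ ?_, fun y z ↦ ?_, fun y z ↦ ?_⟩
    · refine TrivSqZeroExt.ext ?_ ?_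
      · simp [fst_mul']
      · simp [snd_mul', add_comm]
    · refine TrivSqZeroExt.ext ?_ ?_
      · simp [fst_mul', mul_assoc]
      · simp [snd_mul', fst_mul', mul_add, add_mul, mul_assoc, add_assoc]
    · refine TrivSqZeroExt.ext ?_ ?_
      · simp [fst_mul', mul_assoc]
      · simp [snd_mul', fst_mul', mul_add, mul_assoc, add_assoc]
end

section
/- Let K be a field and let X and Y be locally finite posets. There exists a K-algebra anti-isomorphism from D(X,K) to D(Y,K) if and only if there exists an order anti-isomorphism from X to Y. -/
/-- Two elements of a semigroup are Murray–von Neumann equivalent if they are of the form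
`s * t` and `t * s`. -/
def MvnEquiv {A : Type*} [Mul A] (e f : A) : Prop :=
  ∃ s t : A, s * t = e ∧ t * s = f

namespace MvnEquiv

lemma symm {A : Type*} [Mul A] {e f : A} (h : MvnEquiv e f) : MvnEquiv f e :=
  let ⟨s, t, hst, hts⟩ := h
  ⟨t, s, hts, hst⟩

lemma map {A B F : Type*} [Mul A] [Mul B] [FunLike F A B] [MulHomClass F A B] (φ : F) {e f : A}
    (h : MvnEquiv e f) : MvnEquiv (φ e) (φ f) := by
  obtain ⟨s, t, rfl, rfl⟩ := h
  exact ⟨φ s, φ t, (map_mul φ s t).symm, (map_mul φ t s).symm⟩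

lemma exists_corner_ne_zero {A : Type*} [Ring A] {e e' f f' : A} (he : IsIdempotentElem e)
    (he' : IsIdempotentElem e') (h : MvnEquiv e f) (h' : MvnEquiv e' f')
    (H : ∃ a, e * a * e' ≠ 0) : ∃ a, f * a * f' ≠ 0 := by
  obtain ⟨s, t, rfl, rfl⟩ := h
  obtain ⟨s', t', rfl, rfl⟩ := h'
  obtain ⟨a, ha⟩ := H
  refine ⟨t * a * s', fun h0 ↦ ha ?_⟩
  calc s * t * a * (s' * t') = s * t * (s * t) * a * (s' * t' * (s' * t')) := by
        rw [he.eq, he'.eq]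
    _ = s * (t * s * (t * a * s') * (t' * s')) * t' := by simp only [mul_assoc]
    _ = 0 := by rw [h0, mul_zero, zero_mul]

end MvnEquiv

/-- A family of idempotents of a ring `A` indexed by a poset `X`, with local corners whose residue
maps extend to characters of `A`, such that the order on `X` is given by the nonvanishing of
Peirce components and the characters detect idempotents. -/
structure PeirceFrame (A K X : Type*) [Ring A] [Field K] [PartialOrder X] where
  /-- The idempotents. -/
  idem : X → A
  /-- The characters. -/
  char : X → A →+* K
  isIdempotentElem_idem (x : X) : IsIdempotentElem (idem x)
  char_idem_self (x : X) : char x (idem x) = 1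
  char_idem_of_ne (x y : X) : y ≠ x → char y (idem x) = 0
  exists_corner_inverse (x : X) (a : A) : char x a ≠ 0 →
    ∃ c, c * (idem x * a * idem x) = idem x ∧ idem x * a * idem x * c = idem x
  exists_corner_ne_zero_iff (x y : X) : (∃ a, idem x * a * idem y ≠ 0) ↔ x ≤ y
  eq_zero_of_char_eq_zero (f : A) : IsIdempotentElem f → (∀ x, char x f = 0) → f = 0

namespace PeirceFrame

variable {A B K L X Y : Type*} [Ring A] [Ring B] [Field K] [Field L] [PartialOrder X]
  [PartialOrder Y]

lemma idem_ne_zero (F : PeirceFrame A K X) (x : X) : F.idem x ≠ 0 := fun h ↦ by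
  simpa [h] using F.char_idem_self x

/-- The frame of the opposite ring, indexed by the dual poset. -/
def op (F : PeirceFrame A K X) : PeirceFrame Aᵐᵒᵖ K Xᵒᵈ where
  idem x := .op (F.idem (OrderDual.ofDual x))
  char x := (F.char (OrderDual.ofDual x)).fromOpposite fun _ _ ↦ mul_comm _ _
  isIdempotentElem_idem x := by
    rw [IsIdempotentElem, ← MulOpposite.op_mul, (F.isIdempotentElem_idem _).eq]
  char_idem_self x := F.char_idem_self _
  char_idem_of_ne x y h := F.char_idem_of_ne _ _ h
  exists_corner_inverse x a h := by
    obtain ⟨c, hc, hc'⟩ := F.exists_corner_inverse (OrderDual.ofDual x) a.unop h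
    refine ⟨.op c, MulOpposite.unop_injective ?_, MulOpposite.unop_injective ?_⟩
    · simpa [mul_assoc] using hc'
    · simpa [mul_assoc] using hc
  exists_corner_ne_zero_iff x y := by
    rw [← OrderDual.ofDual_le_ofDual, ← F.exists_corner_ne_zero_iff,
      MulOpposite.opEquiv.symm.exists_congr_left]
    refine exists_congr fun a ↦ not_congr ?_
    rw [← MulOpposite.unop_eq_zero_iff]
    simp [mul_assoc]
  eq_zero_of_char_eq_zero f hf h :=
    MulOpposite.unop_injective (F.eq_zero_of_char_eq_zero f.unop
      (by rw [IsIdempotentElem, ← MulOpposite.unop_mul, hf.eq]) h)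

lemma eq_idem_of_isIdempotentElem (F : PeirceFrame A K X) {x : X} {i : A}
    (hi : IsIdempotentElem i) (hl : F.idem x * i = i) (hr : i * F.idem x = i) (h0 : i ≠ 0) :
    i = F.idem x := by
  have hx : F.char x i ≠ 0 := fun h ↦ h0 <| F.eq_zero_of_char_eq_zero i hi fun y ↦ by
    obtain rfl | hy := eq_or_ne y x
    · exact h
    · rw [← hl, map_mul, F.char_idem_of_ne x y hy, zero_mul]
  obtain ⟨c, hc, -⟩ := F.exists_corner_inverse x i hx
  rw [hl, hr] at hc
  rw [← hc, ← hi.eq, ← mul_assoc, hc, hl, hi.eq]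

/-- An idempotent of the second frame is equivalent to the image of an idempotent of the first
as soon as its character does not vanish there. -/
lemma mvnEquiv_of_char_ne_zero (F : PeirceFrame A K X) (G : PeirceFrame B L Y) (φ : A ≃+* B)
    {x : X} {y : Y} (h : G.char y (φ (F.idem x)) ≠ 0) :
    MvnEquiv (G.idem y) (φ (F.idem x)) := by
  obtain ⟨c, -, hc⟩ := G.exists_corner_inverse y _ h
  have hf : φ (F.idem x) * φ (F.idem x) = φ (F.idem x) := by
    rw [← map_mul, (F.isIdempotentElem_idem x).eq]
  have hg := (G.isIdempotentElem_idem y).eq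
  set f := φ (F.idem x)
  set g := G.idem y
  have hst : g * f * (f * g * c) = g := by
    calc g * f * (f * g * c) = g * (f * f) * g * c := by simp only [mul_assoc]
      _ = g := by rw [hf, hc]
  have hts : IsIdempotentElem (f * g * c * (g * f)) := by
    calc f * g * c * (g * f) * (f * g * c * (g * f))
        = f * g * c * (g * f * (f * g * c)) * (g * f) := by simp only [mul_assoc]
      _ = f * g * c * (g * g * f) := by rw [hst]; simp only [mul_assoc]
      _ = _ := by rw [hg]
  refine ⟨g * f, f * g * c, hst, ?_⟩
  have hne : f * g * c * (g * f) ≠ 0 := fun h0 ↦ G.idem_ne_zero y <| by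
    calc g = g * f * (f * g * c) * (g * f * (f * g * c)) := by rw [hst, hg]
      _ = g * f * (f * g * c * (g * f)) * (f * g * c) := by simp only [mul_assoc]
      _ = 0 := by rw [h0, mul_zero, zero_mul]
  have hsymm : φ.symm f = F.idem x := φ.symm_apply_apply _
  rw [← φ.symm.injective.eq_iff, hsymm]
  refine F.eq_idem_of_isIdempotentElem (hts.map φ.symm) ?_ ?_
    ((map_ne_zero_iff φ.symm φ.symm.injective).2 hne)
  · rw [← hsymm, ← map_mul]
    simp only [← mul_assoc, hf]
  · rw [← hsymm, ← map_mul]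
    simp only [mul_assoc, hf]

lemma exists_char_ne_zero (F : PeirceFrame A K X) (G : PeirceFrame B L Y) (φ : A ≃+* B) (x : X) :
    ∃ y, G.char y (φ (F.idem x)) ≠ 0 := by
  by_contra! h
  refine F.idem_ne_zero x ((map_eq_zero_iff φ φ.injective).1 ?_)
  refine G.eq_zero_of_char_eq_zero _ ?_ h
  rw [IsIdempotentElem, ← map_mul, (F.isIdempotentElem_idem x).eq]

theorem nonempty_orderIso (F : PeirceFrame A K X) (G : PeirceFrame B L Y) (φ : A ≃+* B) :
    Nonempty (X ≃o Y) := by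
  choose m hm using F.exists_char_ne_zero G φ
  have le_iff {x x' y y'} (h : G.char y (φ (F.idem x)) ≠ 0)
      (h' : G.char y' (φ (F.idem x')) ≠ 0) : y ≤ y' ↔ x ≤ x' := by
    have e := F.mvnEquiv_of_char_ne_zero G φ h
    have e' := F.mvnEquiv_of_char_ne_zero G φ h'
    have hi (z) : IsIdempotentElem (φ (F.idem z)) := (F.isIdempotentElem_idem z).map φ
    have key : (∃ a, φ (F.idem x) * a * φ (F.idem x') ≠ 0) ↔
        ∃ a, F.idem x * a * F.idem x' ≠ 0 := by
      rw [← φ.toEquiv.exists_congr_right]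
      refine exists_congr fun a ↦ not_congr ?_
      simp [← map_mul]
    rw [← F.exists_corner_ne_zero_iff, ← G.exists_corner_ne_zero_iff, ← key]
    exact ⟨e.exists_corner_ne_zero (G.isIdempotentElem_idem _) (G.isIdempotentElem_idem _) e',
      e.symm.exists_corner_ne_zero (hi _) (hi _) e'.symm⟩
  refine ⟨RelIso.ofSurjective (OrderEmbedding.ofMapLEIff m fun x x' ↦ le_iff (hm x) (hm x'))
    fun y ↦ ?_⟩
  obtain ⟨x, hx⟩ := G.exists_char_ne_zero F φ.symm y
  obtain ⟨s, t, hs, ht⟩ := (G.mvnEquiv_of_char_ne_zero F φ.symm hx).map φ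
  rw [φ.apply_symm_apply] at ht
  have hy : G.char y (φ (F.idem x)) ≠ 0 := by
    rw [← hs, map_mul, mul_comm, ← map_mul, ht, G.char_idem_self]
    exact one_ne_zero
  exact ⟨x, ((le_iff (hm x) hy).2 le_rfl).antisymm ((le_iff hy (hm x)).2 le_rfl)⟩

end PeirceFrame

namespace IncidenceAlgebra

/-- An idempotent with vanishing diagonal is zero. -/
lemma eq_zero_of_isIdempotentElem {K X : Type*} [Field K] [PartialOrder X]
    [LocallyFiniteOrder X] {p : IncidenceAlgebra K X}
    (hp : IsIdempotentElem p)
    (h : ∀ x, p x x = 0) : p = 0 := by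
  have key (n : ℕ) : ∀ a b, (Finset.Icc a b).card ≤ n → p a b = 0 := by
    induction n with
    | zero =>
      intro a b hn
      exact apply_eq_zero_of_not_le (fun hab ↦ by simp [hab] at hn) p
    | succ n ih =>
      intro a b hn
      rw [← hp.eq, mul_apply]
      refine Finset.sum_eq_zero fun z hz ↦ ?_
      obtain ⟨haz, hzb⟩ := Finset.mem_Icc.1 hz
      obtain rfl | hne := eq_or_ne z b
      · rw [h, mul_zero]
      · have hlt : (Finset.Icc a z).card < (Finset.Icc a b).card := Finset.card_lt_card
          (Finset.Icc_ssubset_Icc_right (haz.trans hzb) le_rfl (hzb.lt_of_ne hne))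
        rw [ih a z (by omega), zero_mul]
  ext a b _
  exact key _ a b le_rfl

section Diagonal

variable {K X : Type*} [Field K] [PartialOrder X] [DecidableEq X]

variable (K) in
/-- The indicator function of the interval `[x, x]`. -/
def diagIndicator (x : X) : IncidenceAlgebra K X where
  toFun a b := if a = x ∧ b = x then 1 else 0
  eq_zero_of_not_le' _ _ h := if_neg fun ⟨ha, hb⟩ ↦ h (ha.trans hb.symm).le

lemma diagIndicator_apply (x a b : X) :
    diagIndicator K x a b = if a = x ∧ b = x then 1 else 0 := rfl

variable [LocallyFiniteOrder X]

lemma diagIndicator_mul_apply (x : X) (f : IncidenceAlgebra K X) (a b : X) :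
    (diagIndicator K x * f) a b = if a = x then f x b else 0 := by
  by_cases hab : a ≤ b
  · rw [mul_apply, Finset.sum_eq_single_of_mem a (by simpa using hab)]
    · by_cases h : a = x <;> simp [diagIndicator_apply, h]
    · intro z _ hz
      rw [diagIndicator_apply, if_neg (fun h ↦ hz (h.2.trans h.1.symm)), zero_mul]
  · rw [apply_eq_zero_of_not_le hab]
    split_ifs with h
    · rw [← h, apply_eq_zero_of_not_le hab]
    · rfl

lemma mul_diagIndicator_apply (x : X) (f : IncidenceAlgebra K X) (a b : X) :
    (f * diagIndicator K x) a b = if b = x then f a x else 0 := by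
  by_cases hab : a ≤ b
  · rw [mul_apply, Finset.sum_eq_single_of_mem b (by simpa using hab)]
    · by_cases h : b = x <;> simp [diagIndicator_apply, h]
    · intro z _ hz
      rw [diagIndicator_apply, if_neg (fun h ↦ hz (h.1.trans h.2.symm)), mul_zero]
  · rw [apply_eq_zero_of_not_le hab]
    split_ifs with h
    · rw [← h, apply_eq_zero_of_not_le hab]
    · rfl

lemma diagIndicator_mul_mul_diagIndicator (x : X) (f : IncidenceAlgebra K X) :
    diagIndicator K x * f * diagIndicator K x = f x x • diagIndicator K x := by
  ext a b _
  rw [mul_diagIndicator_apply, diagIndicator_mul_apply, constSMul_apply, diagIndicator_apply]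
  by_cases ha : a = x <;> by_cases hb : b = x <;> simp [ha, hb]

lemma diagIndicator_mul_mul_diagIndicator_of_not_le {x y : X} (h : ¬x ≤ y)
    (f : IncidenceAlgebra K X) : diagIndicator K x * f * diagIndicator K y = 0 := by
  ext a b _
  rw [mul_diagIndicator_apply, diagIndicator_mul_apply, apply_eq_zero_of_not_le h]
  simp

lemma isIdempotentElem_diagIndicator (x : X) : IsIdempotentElem (diagIndicator K x) := by
  ext a b _
  rw [diagIndicator_mul_apply, diagIndicator_apply, diagIndicator_apply]
  by_cases ha : a = x <;> by_cases hb : b = x <;> simp [ha, hb]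

variable (K) in
/-- Evaluation at the interval `[x, x]`. -/
def evalDiag (x : X) : IncidenceAlgebra K X →+* K where
  toFun f := f x x
  map_one' := by simp
  map_mul' f g := by simp
  map_zero' := rfl
  map_add' f g := rfl

lemma evalDiag_apply (x : X) (f : IncidenceAlgebra K X) : evalDiag K x f = f x x := rfl

variable (K X) in
open TrivSqZeroExt in
/-- The frame of the idealization of an incidence algebra given by the indicator functions of
the points. -/
def peirceFrame :
    PeirceFrame (TrivSqZeroExt (IncidenceAlgebra K X) (IncidenceAlgebra K X)) K X where
  idem x := inl (diagIndicator K x)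
  char x := (evalDiag K x).comp (fstHom ℕ (IncidenceAlgebra K X) (IncidenceAlgebra K X)).toRingHom
  isIdempotentElem_idem x := by
    rw [IsIdempotentElem, ← inl_mul, (isIdempotentElem_diagIndicator x).eq]
  char_idem_self x := by simp [evalDiag_apply, diagIndicator_apply]
  char_idem_of_ne x y h := by simp [evalDiag_apply, diagIndicator_apply, h]
  exists_corner_inverse x a h := by
    replace h : a.fst x x ≠ 0 := h
    have hE := (isIdempotentElem_diagIndicator (K := K) x).eq
    have ha : inl (diagIndicator K x) * a * inl (diagIndicator K x) =
        inl (a.fst x x • diagIndicator K x) + inr (a.snd x x • diagIndicator K x) := by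
      ext1 <;> simp [← diagIndicator_mul_mul_diagIndicator]
    rw [ha]
    refine ⟨inl ((a.fst x x)⁻¹ • diagIndicator K x) +
      inr (-((a.fst x x)⁻¹ * a.snd x x * (a.fst x x)⁻¹) • diagIndicator K x), ?_, ?_⟩ <;>
    · ext1
      · simp [hE, h]
      · simp only [snd_mul, fst_add, fst_inl, fst_inr, snd_add, snd_inl, snd_inr, add_zero,
          zero_add, smul_eq_mul, MulOpposite.smul_eq_mul_unop, MulOpposite.unop_op,
          smul_mul_assoc, mul_smul_comm, hE]
        match_scalars
        field_simp
        ring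
  exists_corner_ne_zero_iff x y := by
    classical
    constructor
    · rintro ⟨a, ha⟩
      contrapose! ha
      ext1 <;> simp [diagIndicator_mul_mul_diagIndicator_of_not_le ha]
    · intro h
      refine ⟨inl (zeta K), fun h0 ↦ ?_⟩
      rw [← inl_mul, ← inl_mul] at h0
      have h1 := congrFun (DFunLike.congr_fun (congrArg fst h0) x) y
      rw [fst_inl, mul_diagIndicator_apply, if_pos rfl, diagIndicator_mul_apply, if_pos rfl,
        zeta_of_le h] at h1
      exact one_ne_zero h1
  eq_zero_of_char_eq_zero f hf h := by
    have hfst : f.fst = 0 := eq_zero_of_isIdempotentElem (congrArg fst hf.eq) h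
    ext1
    · exact hfst
    · rw [← hf.eq, snd_mul, hfst]
      simp

end Diagonal

section Reverse

variable {K X Y : Type*} [Field K] [PartialOrder X] [PartialOrder Y]

/-- Transport of an incidence function along an order-reversing bijection. -/
def reverse (μ : X ≃ Y) (hμ : ∀ x y, x ≤ y ↔ μ y ≤ μ x) (f : IncidenceAlgebra K X) :
    IncidenceAlgebra K Y where
  toFun a b := f (μ.symm b) (μ.symm a)
  eq_zero_of_not_le' a b h := apply_eq_zero_of_not_le (fun h' ↦ h <| by simpa [hμ] using h') f

lemma reverse_apply (μ : X ≃ Y) (hμ : ∀ x y, x ≤ y ↔ μ y ≤ μ x) (f : IncidenceAlgebra K X)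
    (a b : Y) : reverse μ hμ f a b = f (μ.symm b) (μ.symm a) := rfl

lemma reverse_mul [LocallyFiniteOrder X] [LocallyFiniteOrder Y]
    (μ : X ≃ Y) (hμ : ∀ x y, x ≤ y ↔ μ y ≤ μ x) (f g : IncidenceAlgebra K X) :
    reverse μ hμ (f * g) = reverse μ hμ g * reverse μ hμ f := by
  ext a b _
  rw [reverse_apply, mul_apply, mul_apply]
  refine Finset.sum_equiv μ (fun z ↦ ?_) fun z _ ↦ ?_
  · simp [hμ, and_comm]
  · simp [reverse_apply, mul_comm]

lemma reverse_bijective (μ : X ≃ Y) (hμ : ∀ x y, x ≤ y ↔ μ y ≤ μ x) :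
    Function.Bijective (reverse (K := K) μ hμ) := by
  refine Function.bijective_iff_has_inverse.2
    ⟨reverse μ.symm fun x y ↦ by simp [hμ], fun f ↦ ?_, fun f ↦ ?_⟩ <;>
  · ext a b _
    simp [reverse_apply]

end Reverse

end IncidenceAlgebra

/-- Let `K` be a field and `X`, `Y` locally finite posets.  There is a `K`-algebra
anti-isomorphism (a `K`-linear bijection reversing products) from
`D(X,K) = I(X,K)(+)I(X,K)` to `D(Y,K)` if and only if there is an order
anti-isomorphism from `X` to `Y`. -/
theorem exists_anti_isomorphism_D_iff_exists_anti_isomorphism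
    (K X Y : Type*) [Field K]
    [PartialOrder X] [LocallyFiniteOrder X] [DecidableEq X]
    [PartialOrder Y] [LocallyFiniteOrder Y] [DecidableEq Y] :
    (∃ Φ : TrivSqZeroExt (IncidenceAlgebra K X) (IncidenceAlgebra K X) →
           TrivSqZeroExt (IncidenceAlgebra K Y) (IncidenceAlgebra K Y),
        Function.Bijective Φ ∧
        (∀ u v, Φ (u + v) = Φ u + Φ v) ∧
        (∀ (k : K) u, Φ (k • u) = k • Φ u) ∧
        (∀ u v, Φ (u * v) = Φ v * Φ u)) ↔
      (∃ μ : X → Y, Function.Bijective μ ∧ ∀ x y : X, x ≤ y ↔ μ y ≤ μ x) := by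
  constructor
  · rintro ⟨Φ, hbij, hadd, -, hmul⟩
    let φ : TrivSqZeroExt (IncidenceAlgebra K X) (IncidenceAlgebra K X) ≃+*
        (TrivSqZeroExt (IncidenceAlgebra K Y) (IncidenceAlgebra K Y))ᵐᵒᵖ :=
      { (Equiv.ofBijective Φ hbij).trans MulOpposite.opEquiv with
        map_mul' := fun u v ↦ congrArg MulOpposite.op (hmul u v)
        map_add' := fun u v ↦ congrArg MulOpposite.op (hadd u v) }
    obtain ⟨m⟩ := (IncidenceAlgebra.peirceFrame K X).nonempty_orderIso
      (IncidenceAlgebra.peirceFrame K Y).op φ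
    exact ⟨fun x ↦ OrderDual.ofDual (m x), m.bijective, fun x y ↦ m.le_iff_le.symm⟩
  · rintro ⟨μ, hbij, hμ⟩
    let R := IncidenceAlgebra.reverse (K := K) (Equiv.ofBijective μ hbij) hμ
    have hR : Function.Bijective R := IncidenceAlgebra.reverse_bijective _ _
    have hRmul (f g) : R (f * g) = R g * R f := IncidenceAlgebra.reverse_mul _ _ f g
    refine ⟨Prod.map R R, hR.prodMap hR, fun _ _ ↦ rfl, fun _ _ ↦ rfl, fun u v ↦ ?_⟩
    refine TrivSqZeroExt.ext (hRmul u.fst v.fst) ?_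
    refine Eq.trans (b := R (u.fst * v.snd) + R (u.snd * v.fst)) rfl ?_
    rw [hRmul, hRmul, add_comm]
    rfl
end

section
/- Suppose the locally finite poset X has an element x₀ that is comparable with every element of X. Let τ : X × X → K be a function such that τ(x,y) + τ(y,z) = τ(x,z) whenever x ≤ y ≤ z. Then the additive derivation L_τ of the incidence algebra A = I(X,K), defined by L_τ(g)(x,y) = τ(x,y)·g(x,y), is an inner derivation: there exists f ∈ A such that L_τ(g) = gf − fg for all g ∈ A. -/
/-- The commutator of an element of an incidence algebra with a diagonal element. -/
theorem IncidenceAlgebra.mul_diagonal_sub_diagonal_mul_apply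
    {K X : Type*} [CommRing K] [PartialOrder X] [LocallyFiniteOrder X] [DecidableEq X]
    (d : X → K) {f : IncidenceAlgebra K X} (hf : ∀ x y, f x y = if x = y then d x else 0)
    (g : IncidenceAlgebra K X) {x y : X} (hxy : x ≤ y) :
    (g * f - f * g) x y = (d y - d x) * g x y := by
  simp only [IncidenceAlgebra.sub_apply, IncidenceAlgebra.mul_apply, hf, mul_ite, ite_mul,
    mul_zero, zero_mul, Finset.sum_ite_eq, Finset.sum_ite_eq', Finset.mem_Icc, hxy, le_refl,
    and_self, if_true]
  ring

/-- On a poset with an element comparable to all others, every additive function on comparable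
pairs is a difference of values of a function of one variable. -/
theorem exists_sub_eq_of_add_eq_of_all_comparable
    {K X : Type*} [AddCommGroup K] [Preorder X]
    (x₀ : X) (hx₀ : ∀ x : X, x ≤ x₀ ∨ x₀ ≤ x) (τ : X → X → K)
    (hτ : ∀ x y z : X, x ≤ y → y ≤ z → τ x y + τ y z = τ x z) :
    ∃ d : X → K, ∀ x y, x ≤ y → d y - d x = τ x y := by
  classical
  refine ⟨fun x => if x₀ ≤ x then τ x₀ x else -τ x x₀, fun x y hxy => ?_⟩
  by_cases hx : x₀ ≤ x
  · simp only [hx, hx.trans hxy, if_true]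
    rw [← hτ x₀ x y hx hxy]
    abel
  · by_cases hy : x₀ ≤ y
    · simp only [hx, hy, if_true, if_false]
      rw [← hτ x x₀ y ((hx₀ x).resolve_right hx) hy]
      abel
    · simp only [hx, hy, if_false]
      rw [← hτ x y x₀ hxy ((hx₀ y).resolve_right hy)]
      abel

/-- Suppose the locally finite poset `X` has an element `x₀` comparable with every element
of `X`, and let `τ : X × X → K` satisfy `τ(x,y) + τ(y,z) = τ(x,z)` whenever
`x ≤ y ≤ z`.  Then the additive derivation `L_τ` of the incidence algebra `A = I(X,K)`,
`L_τ(g)(x,y) = τ(x,y)·g(x,y)`, is inner: there exists `f ∈ A` with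
`L_τ(g) = g f − f g` for every `g ∈ A`. -/
theorem additive_derivation_is_inner_of_all_comparable
    (K X : Type*) [Field K] [PartialOrder X] [LocallyFiniteOrder X] [DecidableEq X]
    (x₀ : X) (hx₀ : ∀ x : X, x ≤ x₀ ∨ x₀ ≤ x)
    (τ : X → X → K)
    (hτ : ∀ x y z : X, x ≤ y → y ≤ z → τ x y + τ y z = τ x z) :
    ∃ f : IncidenceAlgebra K X, ∀ (g : IncidenceAlgebra K X) (x y : X),
      τ x y * g x y = (g * f - f * g) x y := by
  obtain ⟨d, hd⟩ := exists_sub_eq_of_add_eq_of_all_comparable x₀ hx₀ τ hτ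
  refine ⟨⟨fun x y => if x = y then d x else 0, fun x y h => if_neg fun e => h e.le⟩,
    fun g x y => ?_⟩
  by_cases hxy : x ≤ y
  · rw [IncidenceAlgebra.mul_diagonal_sub_diagonal_mul_apply d (fun _ _ => rfl) g hxy, hd x y hxy]
  · rw [IncidenceAlgebra.apply_eq_zero_of_not_le hxy, IncidenceAlgebra.apply_eq_zero_of_not_le hxy,
      mul_zero]
end

section
/- Let Φ be a K-algebra anti-automorphism of D(X,K), for a locally finite poset X. Then: (a) for every i ∈ A, the first component of Φ(0,i) is 0 (so Φ maps the ideal 0(+)A into itself); (b) the map ρ : A → A defined by ρ(f) = first component of Φ(f,0) is a K-algebra anti-automorphism of A; (c) the map φ₂₂ : A → A defined by φ₂₂(i) = second component of Φ(0,i) is a K-linear bijection. Moreover, if Φ is an involution, then ρ is an involution on A and φ₂₂ ∘ φ₂₂ = id. -/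
open TrivSqZeroExt

namespace IncidenceAlgebra

variable {K X : Type*} [PartialOrder X] [DecidableEq X]

/-- The idempotent of the incidence algebra supported at a single diagonal entry. -/
def diagSingle [Zero K] [One K] (x : X) : IncidenceAlgebra K X where
  toFun a b := if a = x ∧ b = x then 1 else 0
  eq_zero_of_not_le' _ _ h := if_neg fun hx => h (hx.1.trans hx.2.symm).le

theorem diagSingle_apply [Zero K] [One K] (x a b : X) :
    (diagSingle x : IncidenceAlgebra K X) a b = if a = x ∧ b = x then 1 else 0 := rfl

variable [LocallyFiniteOrder X]

/-- Central elements of an incidence algebra are diagonal. -/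
theorem apply_eq_zero_of_central [NonAssocSemiring K] {z : IncidenceAlgebra K X}
    (hz : ∀ f, z * f = f * z) {x y : X} (hxy : x ≠ y) : z x y = 0 := by
  by_cases hle : x ≤ y
  · have h := congrArg (fun f : IncidenceAlgebra K X => f x y) (hz (diagSingle x))
    simpa [diagSingle_apply, hxy.symm, hle] using h.symm
  · exact apply_eq_zero_of_not_le hle z

/-- The center of an incidence algebra over a semiring without zero divisors has no
nonzero element of square zero. -/
theorem eq_zero_of_central_of_mul_self [Semiring K] [NoZeroDivisors K]
    {z : IncidenceAlgebra K X} (hz : ∀ f, z * f = f * z) (hsq : z * z = 0) : z = 0 := by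
  ext x y _
  obtain rfl | hxy := eq_or_ne x y
  · have h := congrArg (fun f : IncidenceAlgebra K X => f x x) hsq
    simpa using h
  · exact apply_eq_zero_of_central hz hxy

end IncidenceAlgebra

/-- A surjective additive anti-multiplicative map sends the ideal `0(+)A` into itself. -/
theorem fst_map_inr_eq_zero {K X : Type*} [Field K] [PartialOrder X] [LocallyFiniteOrder X]
    [DecidableEq X] {Φ : TrivSqZeroExt (IncidenceAlgebra K X) (IncidenceAlgebra K X) →
      TrivSqZeroExt (IncidenceAlgebra K X) (IncidenceAlgebra K X)}
    (hadd : ∀ u v, Φ (u + v) = Φ u + Φ v)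
    (hanti : ∀ u v, Φ (u * v) = Φ v * Φ u) (hsurj : Function.Surjective Φ)
    (i : IncidenceAlgebra K X) : (Φ (inr i)).fst = 0 := by
  have hzero : Φ 0 = 0 := by simpa using hadd 0 0
  have hcomm (u : TrivSqZeroExt (IncidenceAlgebra K X) (IncidenceAlgebra K X)) :
      u * inr 1 = inr 1 * u := by
    ext1
    · simp
    · change u.fst * 1 + u.snd * 0 = 0 * u.snd + 1 * u.fst
      simp
  have hone : (Φ (inr 1)).fst = 0 := by
    apply IncidenceAlgebra.eq_zero_of_central_of_mul_self
    · intro f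
      obtain ⟨u, hu⟩ := hsurj (inl f)
      have h := congrArg (fun w => (Φ w).fst) (hcomm u)
      simpa [hanti, hu] using h
    · rw [← fst_mul, ← hanti, inr_mul_inr, hzero, fst_zero]
  have hi : inl i * inr 1 = (inr i : TrivSqZeroExt (IncidenceAlgebra K X) _) := by
    ext1
    · simp
    · change i * 1 + 0 * 0 = i
      simp
  rw [← hi, hanti, fst_mul, hone, zero_mul]

section Components

variable {R M : Type*} [AddZeroClass R] [AddZeroClass M]
  {Φ Ψ : TrivSqZeroExt R M → TrivSqZeroExt R M}

/-- If `Φ` maps `0(+)M` into itself, the first component of `Φ u` depends only on that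
of `u`. -/
theorem fst_map_inl_fst (hadd : ∀ u v, Φ (u + v) = Φ u + Φ v)
    (hinr : ∀ i, (Φ (inr i)).fst = 0) (u : TrivSqZeroExt R M) :
    (Φ (inl u.fst)).fst = (Φ u).fst := by
  conv_rhs => rw [← inl_fst_add_inr_snd_eq u, hadd, fst_add, hinr, add_zero]

theorem leftInverse_fst_map_inl (hadd : ∀ u v, Φ (u + v) = Φ u + Φ v)
    (hinr : ∀ i, (Φ (inr i)).fst = 0) (h : Function.LeftInverse Φ Ψ) :
    Function.LeftInverse (fun f => (Φ (inl f)).fst) (fun f => (Ψ (inl f)).fst) := fun f => by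
  simp only [fst_map_inl_fst hadd hinr, h (inl f), fst_inl]

end Components

theorem leftInverse_snd_map_inr {R M : Type*} [Zero R] {Φ Ψ : TrivSqZeroExt R M → TrivSqZeroExt R M}
    (hinr : ∀ i, (Ψ (inr i)).fst = 0)
    (h : Function.LeftInverse Φ Ψ) :
    Function.LeftInverse (fun i => (Φ (inr i)).snd) (fun i => (Ψ (inr i)).snd) := fun i => by
  have hi : inr (Ψ (inr i)).snd = Ψ (inr i) := by
    ext1
    · rw [fst_inr, hinr]
    · rw [snd_inr]
  simp only [hi, h (inr i), snd_inr]

/-- Let `Φ` be a `K`-algebra anti-automorphism of `D(X,K) = A(+)A`, `A = I(X,K)`.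
Then (a) `Φ` maps the ideal `0(+)A` into itself; (b) `ρ(f) := fst (Φ(f,0))` is a
`K`-algebra anti-automorphism of `A`; (c) `φ₂₂(i) := snd (Φ(0,i))` is a `K`-linear
bijection of `A`.  Moreover if `Φ` is an involution then `ρ` is an involution on `A`
and `φ₂₂ ∘ φ₂₂ = id`. -/
theorem components_of_anti_automorphism_of_D
    (K X : Type*) [Field K] [PartialOrder X] [LocallyFiniteOrder X] [DecidableEq X]
    (Φ : TrivSqZeroExt (IncidenceAlgebra K X) (IncidenceAlgebra K X) →
         TrivSqZeroExt (IncidenceAlgebra K X) (IncidenceAlgebra K X))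
    (hadd : ∀ u v, Φ (u + v) = Φ u + Φ v)
    (hsmul : ∀ (k : K) u, Φ (k • u) = k • Φ u)
    (hanti : ∀ u v, Φ (u * v) = Φ v * Φ u)
    (hbij : Function.Bijective Φ) :
    -- (a)
    (∀ i : IncidenceAlgebra K X, (Φ (inr i)).fst = 0) ∧
    -- (b) `ρ` is a `K`-algebra anti-automorphism of `A`
    (Function.Bijective (fun f : IncidenceAlgebra K X => (Φ (inl f)).fst) ∧
      (∀ f g : IncidenceAlgebra K X,
        (Φ (inl (f + g))).fst = (Φ (inl f)).fst + (Φ (inl g)).fst) ∧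
      (∀ (k : K) (f : IncidenceAlgebra K X),
        (Φ (inl (k • f))).fst = k • (Φ (inl f)).fst) ∧
      (∀ f g : IncidenceAlgebra K X,
        (Φ (inl (f * g))).fst = (Φ (inl g)).fst * (Φ (inl f)).fst)) ∧
    -- (c) `φ₂₂` is a `K`-linear bijection of `A`
    (Function.Bijective (fun i : IncidenceAlgebra K X => (Φ (inr i)).snd) ∧
      (∀ i j : IncidenceAlgebra K X,
        (Φ (inr (i + j))).snd = (Φ (inr i)).snd + (Φ (inr j)).snd) ∧
      (∀ (k : K) (i : IncidenceAlgebra K X),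
        (Φ (inr (k • i))).snd = k • (Φ (inr i)).snd)) ∧
    -- the "moreover" part
    ((∀ u, Φ (Φ u) = u) →
      (∀ f : IncidenceAlgebra K X, (Φ (inl ((Φ (inl f)).fst))).fst = f) ∧
      (∀ i : IncidenceAlgebra K X, (Φ (inr ((Φ (inr i)).snd))).snd = i)) := by
  have hinr := fst_map_inr_eq_zero hadd hanti hbij.surjective
  obtain ⟨Ψ, hΨΦ, hΦΨ⟩ := Function.bijective_iff_has_inverse.mp hbij
  have hadd' (u v) : Ψ (u + v) = Ψ u + Ψ v :=
    hbij.injective (by rw [hadd, hΦΨ, hΦΨ, hΦΨ])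
  have hanti' (u v) : Ψ (u * v) = Ψ v * Ψ u :=
    hbij.injective (by rw [hanti, hΦΨ, hΦΨ, hΦΨ])
  have hinr' := fst_map_inr_eq_zero hadd' hanti' hΨΦ.surjective
  refine ⟨hinr, ⟨?_, ?_, ?_, ?_⟩, ⟨?_, ?_, ?_⟩, fun hinv => ⟨?_, ?_⟩⟩
  · exact ⟨(leftInverse_fst_map_inl hadd' hinr' hΨΦ).injective,
      (leftInverse_fst_map_inl hadd hinr hΦΨ).surjective⟩
  · intro f g
    rw [inl_add, hadd, fst_add]
  · intro k f
    rw [inl_smul, hsmul, fst_smul]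
  · intro f g
    rw [← fst_mul, ← hanti, inl_mul_inl]
  · exact ⟨(leftInverse_snd_map_inr hinr hΨΦ).injective,
      (leftInverse_snd_map_inr hinr' hΦΨ).surjective⟩
  · intro i j
    rw [inr_add, hadd, snd_add]
  · intro k i
    rw [inr_smul, hsmul, snd_smul]
  · exact leftInverse_fst_map_inl hadd hinr hinv
  · exact leftInverse_snd_map_inr hinr hinv
end

section
/- Let Φ be a K-algebra anti-automorphism of D(X,K), for a locally finite poset X. Then there exist a K-algebra anti-automorphism ρ of A, a central unit g of A, and a K-linear derivation D : A → A such that Φ(f,i) = (ρ(f), ρ(g·(D(f) + i))) for all (f,i) ∈ D(X,K). Moreover, if Φ is an involution on D(X,K), then ρ can be taken to be an involution on A. -/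
open TrivSqZeroExt

namespace IncidenceAlgebra

/-- A central element of an incidence algebra over a field which squares to zero is zero. -/
theorem eq_zero_of_mem_center_of_mul_self_eq_zero {K X : Type*} [Field K] [PartialOrder X]
    [LocallyFiniteOrder X] [DecidableEq X] {a : IncidenceAlgebra K X}
    (hc : ∀ f, a * f = f * a) (hsq : a * a = 0) : a = 0 := by
  ext x y _
  by_cases hxy : x = y
  · subst hxy
    have h := congrArg (fun f => f x x) hsq
    simpa [mul_apply] using h
  · let e : IncidenceAlgebra K X :=
      ⟨fun u v => if u = y ∧ v = y then 1 else 0, fun u v huv => by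
        rw [if_neg]
        rintro ⟨rfl, rfl⟩
        exact huv le_rfl⟩
    have he : ∀ u v, e u v = if u = y ∧ v = y then 1 else 0 := fun _ _ => rfl
    have h := congrArg (fun f => f x y) (hc e)
    simp only [mul_apply, he, hxy, false_and, if_false, zero_mul, Finset.sum_const_zero,
      and_true, mul_ite, mul_one, mul_zero] at h
    rw [Finset.sum_ite_eq'] at h
    simp_all

end IncidenceAlgebra

namespace TrivSqZeroExt

theorem eq_inr_snd_of_fst_eq_zero {R M : Type*} [Zero R] {u : TrivSqZeroExt R M}
    (h : u.fst = 0) : u = inr u.snd :=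
  TrivSqZeroExt.ext h rfl

/-- If `A` has no nonzero central elements of square zero, a surjective anti-endomorphism of
`A(+)A` maps the square-zero ideal into itself. -/
theorem fst_anti_inr_eq_zero {A : Type*} [Ring A]
    (hA : ∀ a : A, (∀ f, a * f = f * a) → a * a = 0 → a = 0)
    {Φ : TrivSqZeroExt A A → TrivSqZeroExt A A}
    (hadd : ∀ u v, Φ (u + v) = Φ u + Φ v)
    (hanti : ∀ u v, Φ (u * v) = Φ v * Φ u)
    (hsurj : Function.Surjective Φ) (i : A) : (Φ (inr i)).fst = 0 := by
  have h0 : Φ 0 = 0 := by simpa using hadd 0 0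
  have hone : (Φ (inr 1)).fst = 0 := by
    refine hA _ (fun f => ?_) ?_
    · obtain ⟨u, hu⟩ := hsurj (inl f)
      have hc : inr 1 * u = u * inr 1 := by ext <;> simp
      have h := congrArg (fun v => (Φ v).fst) hc
      simpa [hanti, hu] using h.symm
    · have h := hanti (inr 1) (inr 1)
      rw [inr_mul_inr, h0] at h
      simpa using (congrArg fst h).symm
  have hi : (inr i : TrivSqZeroExt A A) = inl i * inr 1 := by ext <;> simp
  rw [hi, hanti, fst_mul, hone, zero_mul]

/-- Anti-automorphisms of `A(+)A` decompose when `A` has no nonzero central elements of square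
zero. -/
theorem exists_decomposition_of_anti {K A : Type*} [Field K] [Ring A] [Module K A]
    [SMulCommClass K A A]
    (hA : ∀ a : A, (∀ f, a * f = f * a) → a * a = 0 → a = 0)
    (Φ : TrivSqZeroExt A A → TrivSqZeroExt A A)
    (hadd : ∀ u v, Φ (u + v) = Φ u + Φ v)
    (hsmul : ∀ (k : K) u, Φ (k • u) = k • Φ u)
    (hanti : ∀ u v, Φ (u * v) = Φ v * Φ u)
    (hbij : Function.Bijective Φ) :
    ∃ (ρ : A → A) (g : A) (Der : A → A),
      Function.Bijective ρ ∧
      (∀ f₁ f₂, ρ (f₁ + f₂) = ρ f₁ + ρ f₂) ∧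
      (∀ (k : K) f, ρ (k • f) = k • ρ f) ∧
      (∀ f₁ f₂, ρ (f₁ * f₂) = ρ f₂ * ρ f₁) ∧
      ((∀ u, Φ (Φ u) = u) → ∀ f, ρ (ρ f) = f) ∧
      IsUnit g ∧ g ∈ Set.center A ∧
      (∀ f₁ f₂, Der (f₁ + f₂) = Der f₁ + Der f₂) ∧
      (∀ (k : K) f, Der (k • f) = k • Der f) ∧
      (∀ f₁ f₂, Der (f₁ * f₂) = Der f₁ * f₂ + f₁ * Der f₂) ∧
      (∀ f i : A, Φ (inl f + inr i) = inl (ρ f) + inr (ρ (g * (Der f + i)))) := by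
  have hN := fst_anti_inr_eq_zero hA hadd hanti hbij.surjective
  let Ψ := (Equiv.ofBijective Φ hbij).symm
  have hΦΨ : ∀ u, Φ (Ψ u) = u := (Equiv.ofBijective Φ hbij).apply_symm_apply
  have hΨΦ : ∀ u, Ψ (Φ u) = u := (Equiv.ofBijective Φ hbij).symm_apply_apply
  have hN' := fst_anti_inr_eq_zero (Φ := Ψ) hA
    (fun u v => hbij.injective (by simp only [hadd, hΦΨ]))
    (fun u v => hbij.injective (by simp only [hanti, hΦΨ])) Ψ.surjective
  obtain ⟨ρ, hρ⟩ : ∃ ρ : A → A, ∀ f, ρ f = (Φ (inl f)).fst := ⟨_, fun _ => rfl⟩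
  have hfst : ∀ u, (Φ u).fst = ρ u.fst := fun u => by
    conv_lhs => rw [← inl_fst_add_inr_snd_eq u, hadd, fst_add, hN, add_zero, ← hρ]
  have radd : ∀ f₁ f₂, ρ (f₁ + f₂) = ρ f₁ + ρ f₂ := fun f₁ f₂ => by
    simp only [hρ, inl_add, hadd, fst_add]
  have rsmul : ∀ (k : K) f, ρ (k • f) = k • ρ f := fun k f => by
    simp only [hρ, inl_smul, hsmul, fst_smul]
  have rmul : ∀ f₁ f₂, ρ (f₁ * f₂) = ρ f₂ * ρ f₁ := fun f₁ f₂ => by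
    have h : (inl (f₁ * f₂) : TrivSqZeroExt A A) = inl f₁ * inl f₂ := inl_mul A f₁ f₂
    simp only [hρ, h, hanti, fst_mul]
  have rsurj : Function.Surjective ρ := fun f => ⟨(Ψ (inl f)).fst, by
    rw [← hfst, hΦΨ, fst_inl]⟩
  have rinj : Function.Injective ρ := by
    intro f₁ f₂ h
    have h0 : ρ (f₁ - f₂) = 0 := by
      have := radd (f₁ - f₂) f₂
      rw [sub_add_cancel, h] at this
      simpa using this
    rw [hρ] at h0
    have h1 := eq_inr_snd_of_fst_eq_zero h0
    have h2 := hN' (Φ (inl (f₁ - f₂))).snd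
    rw [← h1, hΨΦ, fst_inl] at h2
    exact sub_eq_zero.mp h2
  have rone : ρ 1 = 1 := by
    obtain ⟨f, hf⟩ := rsurj 1
    simpa [hf] using (rmul 1 f).symm
  obtain ⟨b, hb⟩ : ∃ b, Φ (inr 1) = inr b :=
    ⟨_, eq_inr_snd_of_fst_eq_zero (hN 1)⟩
  obtain ⟨g, rfl⟩ := rsurj b
  have hinr : ∀ i, Φ (inr i) = inr (ρ (i * g)) := fun i => by
    have hi : (inr i : TrivSqZeroExt A A) = inl i * inr 1 := by ext <;> simp
    rw [hi, hanti, hb, rmul]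
    ext <;> simp [hρ]
  have gcomm : ∀ f, g * f = f * g := fun f => rinj <| by
    have hi : (inr f : TrivSqZeroExt A A) = inr 1 * inl f := by ext <;> simp
    have h := hinr f
    rw [hi, hanti, hb] at h
    have h := congrArg snd h
    simp only [snd_mul, snd_inr, fst_inr, ← hρ] at h
    rw [rmul g f]
    simpa using h
  obtain ⟨g', hg'⟩ : ∃ g', g' * g = 1 := by
    refine ⟨(Ψ (inr 1)).snd, rinj ?_⟩
    have h := eq_inr_snd_of_fst_eq_zero (hN' 1)
    have h2 := hΦΨ (inr 1)
    rw [h, hinr] at h2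
    rw [rone]
    exact inr_injective h2
  have hgg' : g * g' = 1 := (gcomm g').trans hg'
  choose σ hσ using rsurj
  have hd : ∀ f, ρ (g * (g' * σ (Φ (inl f)).snd)) = (Φ (inl f)).snd := fun f => by
    rw [← mul_assoc, hgg', one_mul, hσ]
  obtain ⟨Der, hD⟩ : ∃ Der : A → A, ∀ f, ρ (g * Der f) = (Φ (inl f)).snd := ⟨_, hd⟩
  have cancel : ∀ x y, ρ (g * x) = ρ (g * y) → x = y := fun x y h => by
    have h := congrArg (g' * ·) (rinj h)
    simpa [← mul_assoc, hg'] using h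
  refine ⟨ρ, g, Der, ⟨rinj, fun f => ⟨σ f, hσ f⟩⟩, radd, rsmul, rmul, fun hinv f => ?_,
    ⟨⟨g, g', hgg', hg'⟩, rfl⟩, Semigroup.mem_center_iff.mpr fun f => (gcomm f).symm,
    fun f₁ f₂ => cancel _ _ ?_, fun k f => cancel _ _ ?_, fun f₁ f₂ => cancel _ _ ?_,
    fun f i => ?_⟩
  · rw [hρ f, ← hfst, hinv, fst_inl]
  · rw [mul_add, radd, hD, hD, hD, inl_add, hadd, snd_add]
  · rw [mul_smul_comm, rsmul, hD, hD, inl_smul, hsmul, snd_smul]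
  · have h : (inl (f₁ * f₂) : TrivSqZeroExt A A) = inl f₁ * inl f₂ := inl_mul A f₁ f₂
    rw [mul_add, radd, hD, ← mul_assoc, ← mul_assoc, gcomm f₁, mul_assoc f₁, rmul (g * Der f₁),
      rmul f₁, hD, hD, h, hanti, snd_mul, hρ, hρ]
    simp
  · rw [hadd, hinr, mul_add, radd, hD, gcomm i]
    ext <;> simp [hρ]

end TrivSqZeroExt

open TrivSqZeroExt

/-- Let `Φ` be a `K`-algebra anti-automorphism of `D(X,K) = A(+)A`, `A = I(X,K)`.  Then
there exist a `K`-algebra anti-automorphism `ρ` of `A`, a central unit `g` of `A` and a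
`K`-linear derivation `Der : A → A` such that
`Φ(f,i) = (ρ(f), ρ(g·(Der(f) + i)))` for all `(f,i)`.  Moreover, if `Φ` is an involution
then `ρ` can be taken to be an involution on `A`. -/
theorem decomposition_of_anti_automorphism_of_D
    (K X : Type*) [Field K] [PartialOrder X] [LocallyFiniteOrder X] [DecidableEq X]
    (Φ : TrivSqZeroExt (IncidenceAlgebra K X) (IncidenceAlgebra K X) →
         TrivSqZeroExt (IncidenceAlgebra K X) (IncidenceAlgebra K X))
    (hadd : ∀ u v, Φ (u + v) = Φ u + Φ v)
    (hsmul : ∀ (k : K) u, Φ (k • u) = k • Φ u)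
    (hanti : ∀ u v, Φ (u * v) = Φ v * Φ u)
    (hbij : Function.Bijective Φ) :
    (∃ (ρ : IncidenceAlgebra K X → IncidenceAlgebra K X) (g : IncidenceAlgebra K X)
        (Der : IncidenceAlgebra K X → IncidenceAlgebra K X),
      Function.Bijective ρ ∧
      (∀ f₁ f₂, ρ (f₁ + f₂) = ρ f₁ + ρ f₂) ∧
      (∀ (k : K) f, ρ (k • f) = k • ρ f) ∧
      (∀ f₁ f₂, ρ (f₁ * f₂) = ρ f₂ * ρ f₁) ∧
      IsUnit g ∧ g ∈ Set.center (IncidenceAlgebra K X) ∧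
      (∀ f₁ f₂, Der (f₁ + f₂) = Der f₁ + Der f₂) ∧
      (∀ (k : K) f, Der (k • f) = k • Der f) ∧
      (∀ f₁ f₂, Der (f₁ * f₂) = Der f₁ * f₂ + f₁ * Der f₂) ∧
      (∀ f i : IncidenceAlgebra K X,
        Φ (inl f + inr i) = inl (ρ f) + inr (ρ (g * (Der f + i))))) ∧
    ((∀ u, Φ (Φ u) = u) →
      ∃ (ρ : IncidenceAlgebra K X → IncidenceAlgebra K X) (g : IncidenceAlgebra K X)
          (Der : IncidenceAlgebra K X → IncidenceAlgebra K X),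
        Function.Bijective ρ ∧
        (∀ f₁ f₂, ρ (f₁ + f₂) = ρ f₁ + ρ f₂) ∧
        (∀ (k : K) f, ρ (k • f) = k • ρ f) ∧
        (∀ f₁ f₂, ρ (f₁ * f₂) = ρ f₂ * ρ f₁) ∧
        (∀ f, ρ (ρ f) = f) ∧
        IsUnit g ∧ g ∈ Set.center (IncidenceAlgebra K X) ∧
        (∀ f₁ f₂, Der (f₁ + f₂) = Der f₁ + Der f₂) ∧
        (∀ (k : K) f, Der (k • f) = k • Der f) ∧
        (∀ f₁ f₂, Der (f₁ * f₂) = Der f₁ * f₂ + f₁ * Der f₂) ∧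
        (∀ f i : IncidenceAlgebra K X,
          Φ (inl f + inr i) = inl (ρ f) + inr (ρ (g * (Der f + i))))) := by
  obtain ⟨ρ, g, Der, hb, ha, hs, hm, hi, hu, hc, hda, hds, hdm, hΦ⟩ :=
    exists_decomposition_of_anti (K := K)
      (fun _ => IncidenceAlgebra.eq_zero_of_mem_center_of_mul_self_eq_zero) Φ hadd hsmul hanti hbij
  exact ⟨⟨ρ, g, Der, hb, ha, hs, hm, hu, hc, hda, hds, hdm, hΦ⟩,
    fun h => ⟨ρ, g, Der, hb, ha, hs, hm, hi h, hu, hc, hda, hds, hdm, hΦ⟩⟩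
end

section
/- Let X be a locally finite poset and let ρ₁, ρ₂ be involutions on A = I(X,K). For ρ an involution on A, let ρ̃ denote the involution (f,i) ↦ (ρ(f), ρ(i)) of D(X,K) and let ρ̃∘(−δ)~ denote the involution (f,i) ↦ (ρ(f), −ρ(i)). Then the following are equivalent: (i) there exists a K-algebra automorphism η of A with η ∘ ρ₁ = ρ₂ ∘ η; (ii) there exists a K-algebra automorphism Ψ of D(X,K) with Ψ ∘ ρ̃₁ = ρ̃₂ ∘ Ψ; (iii) there exists a K-algebra automorphism Ψ of D(X,K) with Ψ ∘ (ρ̃₁∘(−δ)~) = (ρ̃₂∘(−δ)~) ∘ Ψ. The same three statements are also equivalent when 'automorphism' is replaced by 'inner automorphism' throughout. -/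
open TrivSqZeroExt

/-- `η` is a `K`-algebra automorphism of the incidence algebra `A = I(X,K)`. -/
def IsAutA (K X : Type*) [Field K] [PartialOrder X] [LocallyFiniteOrder X] [DecidableEq X]
    (η : IncidenceAlgebra K X → IncidenceAlgebra K X) : Prop :=
  Function.Bijective η ∧ (∀ f g, η (f + g) = η f + η g) ∧
    (∀ (k : K) (f : IncidenceAlgebra K X), η (k • f) = k • η f) ∧
    (∀ f g, η (f * g) = η f * η g)

/-- `Ψ` is a `K`-algebra automorphism of `D(X,K) = A(+)A`. -/
def IsAutD (K X : Type*) [Field K] [PartialOrder X] [LocallyFiniteOrder X] [DecidableEq X]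
    (Ψ : TrivSqZeroExt (IncidenceAlgebra K X) (IncidenceAlgebra K X) →
         TrivSqZeroExt (IncidenceAlgebra K X) (IncidenceAlgebra K X)) : Prop :=
  Function.Bijective Ψ ∧ (∀ u v, Ψ (u + v) = Ψ u + Ψ v) ∧
    (∀ (k : K) u, Ψ (k • u) = k • Ψ u) ∧ (∀ u v, Ψ (u * v) = Ψ u * Ψ v)

/-- For an involution `ρ` on `A`, the involution `ρ̃ : (f,i) ↦ (ρ(f), ρ(i))` of `D(X,K)`. -/
def tildePlus (K X : Type*) [Field K] [PartialOrder X] [LocallyFiniteOrder X] [DecidableEq X]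
    (ρ : IncidenceAlgebra K X → IncidenceAlgebra K X)
    (d : TrivSqZeroExt (IncidenceAlgebra K X) (IncidenceAlgebra K X)) :
    TrivSqZeroExt (IncidenceAlgebra K X) (IncidenceAlgebra K X) :=
  inl (ρ d.fst) + inr (ρ d.snd)

/-- For an involution `ρ` on `A`, the involution `ρ̃ ∘ (−δ)~ : (f,i) ↦ (ρ(f), −ρ(i))`. -/
def tildeMinus (K X : Type*) [Field K] [PartialOrder X] [LocallyFiniteOrder X] [DecidableEq X]
    (ρ : IncidenceAlgebra K X → IncidenceAlgebra K X)
    (d : TrivSqZeroExt (IncidenceAlgebra K X) (IncidenceAlgebra K X)) :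
    TrivSqZeroExt (IncidenceAlgebra K X) (IncidenceAlgebra K X) :=
  inl (ρ d.fst) + inr (-(ρ d.snd))

/-- A central element of the incidence algebra with zero square vanishes. -/
lemma IncidenceAlgebra.eq_zero_of_central_of_mul_self_eq_zero
    {K X : Type*} [Field K] [PartialOrder X] [LocallyFiniteOrder X] [DecidableEq X]
    {f : IncidenceAlgebra K X} (hf : ∀ g, f * g = g * f) (hsq : f * f = 0) : f = 0 := by
  ext a b hab
  obtain rfl | hne := eq_or_ne a b
  · have h : (f * f) a a = 0 := by rw [hsq]; rfl
    simpa using h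
  · let e : IncidenceAlgebra K X :=
      ⟨fun x y ↦ if x = b ∧ y = b then 1 else 0, fun x y hxy ↦
        if_neg fun h ↦ hxy (h.1.trans h.2.symm).le⟩
    have h : (f * e) a b = (e * f) a b := by rw [hf]
    have he (x y : X) : e x y = if x = b ∧ y = b then 1 else 0 := rfl
    simpa [he, hab, hne] using h

section

variable {K X : Type*} [Field K] [PartialOrder X] [LocallyFiniteOrder X] [DecidableEq X]

local notation "A" => IncidenceAlgebra K X
local notation "D" => TrivSqZeroExt (IncidenceAlgebra K X) (IncidenceAlgebra K X)

lemma inr_one_mul (d : D) : (inr 1 : D) * d = inr d.fst := by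
  ext1 <;> simp

lemma mul_inr_one (d : D) : d * (inr 1 : D) = inr d.fst := by
  ext1 <;> simp

/-- An automorphism of `D(X,K)` maps the ideal `0 (+) A` into itself, because it maps the central
square-zero element `(0, 1)` to another such element. -/
lemma IsAutD.fst_inr {Ψ : D → D} (hΨ : IsAutD K X Ψ) (i : A) : (Ψ (inr i)).fst = 0 := by
  obtain ⟨hbij, hadd, -, hmul⟩ := hΨ
  have hzero : Ψ 0 = 0 := by simpa using hadd 0 0
  have hone : (Ψ (inr 1)).fst = 0 := by
    apply IncidenceAlgebra.eq_zero_of_central_of_mul_self_eq_zero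
    · intro g
      obtain ⟨d, hd⟩ := hbij.surjective (inl g)
      have h := congrArg (fun u ↦ (Ψ u).fst) ((inr_one_mul d).trans (mul_inr_one d).symm)
      simpa [hmul, hd] using h
    · have h := congrArg fst (hmul (inr 1) (inr 1))
      rw [inr_mul_inr, hzero] at h
      simpa using h.symm
  have h := congrArg fst (hmul (inr 1) (inl i))
  rwa [inr_one_mul, fst_inl, fst_mul, hone, zero_mul] at h

lemma IsAutD.exists_inverse {Ψ : D → D} (hΨ : IsAutD K X Ψ) :
    ∃ Φ, IsAutD K X Φ ∧ (∀ d, Φ (Ψ d) = d) ∧ ∀ d, Ψ (Φ d) = d := by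
  obtain ⟨hbij, hadd, hsmul, hmul⟩ := hΨ
  obtain ⟨Φ, hl, hr⟩ := Function.bijective_iff_has_inverse.1 hbij
  refine ⟨Φ, ⟨⟨hr.injective, hl.surjective⟩, fun u v ↦ hbij.injective ?_,
    fun k u ↦ hbij.injective ?_, fun u v ↦ hbij.injective ?_⟩, hl, hr⟩
  · rw [hadd, hr, hr, hr]
  · rw [hsmul, hr, hr]
  · rw [hmul, hr, hr, hr]

/-- An automorphism of `D(X,K)` induces an automorphism of `A = D(X,K) / (0 (+) A)`. -/
lemma IsAutD.isAutA_fst {Ψ : D → D} (hΨ : IsAutD K X Ψ) :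
    IsAutA K X fun f ↦ (Ψ (inl f)).fst := by
  obtain ⟨Φ, hΦ, hl, hr⟩ := hΨ.exists_inverse
  have key {Θ : D → D} (hΘ : IsAutD K X Θ) (d : D) : (Θ (inl d.fst)).fst = (Θ d).fst := by
    conv_rhs => rw [← inl_fst_add_inr_snd_eq d, hΘ.2.1, fst_add, hΘ.fst_inr, add_zero]
  refine ⟨Function.bijective_iff_has_inverse.2 ⟨fun f ↦ (Φ (inl f)).fst, fun f ↦ ?_, fun f ↦ ?_⟩,
    fun f g ↦ ?_, fun k f ↦ ?_, fun f g ↦ ?_⟩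
  · simp [key hΦ, hl]
  · simp [key hΨ, hr]
  · simp [hΨ.2.1]
  · simp [inl_smul, hΨ.2.2.1]
  · simp [hΨ.2.2.2]

/-- An automorphism of `A` acts componentwise as an automorphism of `D(X,K)`. -/
lemma IsAutA.isAutD_map {η : A → A} (hη : IsAutA K X η) :
    IsAutD K X fun d ↦ inl (η d.fst) + inr (η d.snd) := by
  obtain ⟨hbij, hadd, hsmul, hmul⟩ := hη
  refine ⟨⟨fun u v h ↦ ?_, fun d ↦ ?_⟩, fun u v ↦ ?_, fun k u ↦ ?_, fun u v ↦ ?_⟩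
  · ext1
    · exact hbij.injective (by simpa using congrArg fst h)
    · exact hbij.injective (by simpa using congrArg snd h)
  · obtain ⟨f, hf⟩ := hbij.surjective d.fst
    obtain ⟨i, hi⟩ := hbij.surjective d.snd
    exact ⟨inl f + inr i, by ext1 <;> simp [hf, hi]⟩
  · ext1 <;> simp [hadd]
  · ext1 <;> simp [hsmul]
  · ext1
    · simp [hmul]
    · have h : η (u.fst * v.snd + u.snd * v.fst) = η u.fst * η v.snd + η u.snd * η v.fst := by
        rw [hadd, hmul, hmul]
      simpa using h

@[simp] lemma fst_tildePlus (ρ : A → A) (d : D) : (tildePlus K X ρ d).fst = ρ d.fst := by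
  simp [tildePlus]

@[simp] lemma snd_tildePlus (ρ : A → A) (d : D) : (tildePlus K X ρ d).snd = ρ d.snd := by
  simp [tildePlus]

@[simp] lemma fst_tildeMinus (ρ : A → A) (d : D) : (tildeMinus K X ρ d).fst = ρ d.fst := by
  simp [tildeMinus]

@[simp] lemma snd_tildeMinus (ρ : A → A) (d : D) : (tildeMinus K X ρ d).snd = -ρ d.snd := by
  simp [tildeMinus]

/-- Maps of `A` are conjugate by an automorphism of `A` as soon as lifts of them to `D(X,K)` are
conjugate by an automorphism of `D(X,K)`. -/
lemma exists_isAutA_of_exists_isAutD {ρ₁ ρ₂ : A → A} {T₁ T₂ : D → D}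
    (hT₁ : ∀ d, (T₁ d).fst = ρ₁ d.fst) (hT₂ : ∀ d, (T₂ d).fst = ρ₂ d.fst)
    (h : ∃ Ψ, IsAutD K X Ψ ∧ ∀ d, Ψ (T₁ d) = T₂ (Ψ d)) :
    ∃ η, IsAutA K X η ∧ ∀ f, η (ρ₁ f) = ρ₂ (η f) := by
  obtain ⟨Ψ, hΨ, hcomm⟩ := h
  refine ⟨_, hΨ.isAutA_fst, fun f ↦ ?_⟩
  have h := congrArg fst (hcomm (inl f))
  rw [hT₂, ← inl_fst_add_inr_snd_eq (T₁ (inl f)), hΨ.2.1, fst_add, hΨ.fst_inr, add_zero, hT₁,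
    fst_inl] at h
  exact h

/-- Maps of `A` are conjugate by an inner automorphism of `A` as soon as lifts of them to `D(X,K)`
are conjugate by an inner automorphism of `D(X,K)`. -/
lemma exists_unit_of_exists_unit_trivSqZeroExt {ρ₁ ρ₂ : A → A} {T₁ T₂ : D → D}
    (hT₁ : ∀ d, (T₁ d).fst = ρ₁ d.fst) (hT₂ : ∀ d, (T₂ d).fst = ρ₂ d.fst)
    (h : ∃ θ : Dˣ, ∀ d, ↑θ * T₁ d * ↑θ⁻¹ = T₂ (↑θ * d * ↑θ⁻¹)) :
    ∃ u : Aˣ, ∀ f, ↑u * ρ₁ f * ↑u⁻¹ = ρ₂ (↑u * f * ↑u⁻¹) := by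
  obtain ⟨θ, hθ⟩ := h
  refine ⟨⟨(θ : D).fst, (↑θ⁻¹ : D).fst, ?_, ?_⟩, fun f ↦ ?_⟩
  · rw [← fst_mul, θ.mul_inv, fst_one]
  · rw [← fst_mul, θ.inv_mul, fst_one]
  · simpa [hT₁, hT₂] using congrArg fst (hθ (inl f))

/-- The unit `(u, 0)` of `D(X,K)` attached to a unit `u` of `A`. -/
def inlUnit (u : Aˣ) : Dˣ where
  val := inl u
  inv := inl ↑u⁻¹
  val_inv := by rw [← inl_mul, u.mul_inv, inl_one]
  inv_val := by rw [← inl_mul, u.inv_mul, inl_one]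

lemma fst_inlUnit_conj (u : Aˣ) (d : D) :
    ((inlUnit u : D) * d * ↑(inlUnit u)⁻¹).fst = ↑u * d.fst * ↑u⁻¹ := rfl

lemma snd_inlUnit_conj (u : Aˣ) (d : D) :
    ((inlUnit u : D) * d * ↑(inlUnit u)⁻¹).snd = ↑u * d.snd * ↑u⁻¹ := by
  change ((inl (u : A) : D) * d * inl (↑u⁻¹ : A)).snd = _
  simp

end

/-- For involutions `ρ₁, ρ₂` on `A = I(X,K)`, the following are equivalent: (i) `ρ₁` and
`ρ₂` are conjugate by a `K`-algebra automorphism of `A`; (ii) `ρ̃₁` and `ρ̃₂` are conjugate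
by a `K`-algebra automorphism of `D(X,K)`; (iii) `ρ̃₁∘(−δ)~` and `ρ̃₂∘(−δ)~` are conjugate
by a `K`-algebra automorphism of `D(X,K)`.  The same holds with "automorphism" replaced by
"inner automorphism" throughout. -/
theorem equivalence_of_involutions_on_A_iff_on_D
    (K X : Type*) [Field K] [PartialOrder X] [LocallyFiniteOrder X] [DecidableEq X]
    (ρ₁ ρ₂ : IncidenceAlgebra K X → IncidenceAlgebra K X)
    (h1add : ∀ f g, ρ₁ (f + g) = ρ₁ f + ρ₁ g)
    (h1smul : ∀ (k : K) (f : IncidenceAlgebra K X), ρ₁ (k • f) = k • ρ₁ f)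
    (h1anti : ∀ f g, ρ₁ (f * g) = ρ₁ g * ρ₁ f)
    (h1bij : Function.Bijective ρ₁)
    (h1invo : ∀ f, ρ₁ (ρ₁ f) = f)
    (h2add : ∀ f g, ρ₂ (f + g) = ρ₂ f + ρ₂ g)
    (h2smul : ∀ (k : K) (f : IncidenceAlgebra K X), ρ₂ (k • f) = k • ρ₂ f)
    (h2anti : ∀ f g, ρ₂ (f * g) = ρ₂ g * ρ₂ f)
    (h2bij : Function.Bijective ρ₂)
    (h2invo : ∀ f, ρ₂ (ρ₂ f) = f) :
    ((∃ η, IsAutA K X η ∧ ∀ f, η (ρ₁ f) = ρ₂ (η f)) ↔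
      (∃ Ψ, IsAutD K X Ψ ∧ ∀ d, Ψ (tildePlus K X ρ₁ d) = tildePlus K X ρ₂ (Ψ d))) ∧
    ((∃ Ψ, IsAutD K X Ψ ∧ ∀ d, Ψ (tildePlus K X ρ₁ d) = tildePlus K X ρ₂ (Ψ d)) ↔
      (∃ Ψ, IsAutD K X Ψ ∧ ∀ d, Ψ (tildeMinus K X ρ₁ d) = tildeMinus K X ρ₂ (Ψ d))) ∧
    ((∃ u : (IncidenceAlgebra K X)ˣ, ∀ f, ↑u * ρ₁ f * ↑u⁻¹ = ρ₂ (↑u * f * ↑u⁻¹)) ↔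
      (∃ θ : (TrivSqZeroExt (IncidenceAlgebra K X) (IncidenceAlgebra K X))ˣ,
        ∀ d, ↑θ * tildePlus K X ρ₁ d * ↑θ⁻¹ = tildePlus K X ρ₂ (↑θ * d * ↑θ⁻¹))) ∧
    ((∃ θ : (TrivSqZeroExt (IncidenceAlgebra K X) (IncidenceAlgebra K X))ˣ,
        ∀ d, ↑θ * tildePlus K X ρ₁ d * ↑θ⁻¹ = tildePlus K X ρ₂ (↑θ * d * ↑θ⁻¹)) ↔
      (∃ θ : (TrivSqZeroExt (IncidenceAlgebra K X) (IncidenceAlgebra K X))ˣ,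
        ∀ d, ↑θ * tildeMinus K X ρ₁ d * ↑θ⁻¹ = tildeMinus K X ρ₂ (↑θ * d * ↑θ⁻¹))) := by
  have hplus : (∃ η, IsAutA K X η ∧ ∀ f, η (ρ₁ f) = ρ₂ (η f)) ↔
      ∃ Ψ, IsAutD K X Ψ ∧ ∀ d, Ψ (tildePlus K X ρ₁ d) = tildePlus K X ρ₂ (Ψ d) := by
    refine ⟨?_, exists_isAutA_of_exists_isAutD (fst_tildePlus ρ₁) (fst_tildePlus ρ₂)⟩
    rintro ⟨η, hη, hcomm⟩
    exact ⟨_, hη.isAutD_map, fun d ↦ by ext1 <;> simp [hcomm]⟩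
  have hminus : (∃ η, IsAutA K X η ∧ ∀ f, η (ρ₁ f) = ρ₂ (η f)) ↔
      ∃ Ψ, IsAutD K X Ψ ∧ ∀ d, Ψ (tildeMinus K X ρ₁ d) = tildeMinus K X ρ₂ (Ψ d) := by
    refine ⟨?_, exists_isAutA_of_exists_isAutD (fst_tildeMinus ρ₁) (fst_tildeMinus ρ₂)⟩
    rintro ⟨η, hη, hcomm⟩
    have hηneg (f) : η (-f) = -η f := (AddMonoidHom.mk' η hη.2.1).map_neg f
    exact ⟨_, hη.isAutD_map, fun d ↦ by ext1 <;> simp [hcomm, hηneg]⟩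
  have hplus' : (∃ u : (IncidenceAlgebra K X)ˣ, ∀ f, ↑u * ρ₁ f * ↑u⁻¹ = ρ₂ (↑u * f * ↑u⁻¹)) ↔
      ∃ θ : (TrivSqZeroExt (IncidenceAlgebra K X) (IncidenceAlgebra K X))ˣ,
        ∀ d, ↑θ * tildePlus K X ρ₁ d * ↑θ⁻¹ = tildePlus K X ρ₂ (↑θ * d * ↑θ⁻¹) := by
    refine ⟨?_, exists_unit_of_exists_unit_trivSqZeroExt (fst_tildePlus ρ₁) (fst_tildePlus ρ₂)⟩
    rintro ⟨u, hu⟩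
    refine ⟨inlUnit u, fun d ↦ ?_⟩
    ext1
    · rw [fst_inlUnit_conj, fst_tildePlus, fst_tildePlus, fst_inlUnit_conj, hu]
    · rw [snd_inlUnit_conj, snd_tildePlus, snd_tildePlus, snd_inlUnit_conj, hu]
  have hminus' : (∃ u : (IncidenceAlgebra K X)ˣ, ∀ f, ↑u * ρ₁ f * ↑u⁻¹ = ρ₂ (↑u * f * ↑u⁻¹)) ↔
      ∃ θ : (TrivSqZeroExt (IncidenceAlgebra K X) (IncidenceAlgebra K X))ˣ,
        ∀ d, ↑θ * tildeMinus K X ρ₁ d * ↑θ⁻¹ = tildeMinus K X ρ₂ (↑θ * d * ↑θ⁻¹) := by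
    refine ⟨?_, exists_unit_of_exists_unit_trivSqZeroExt (fst_tildeMinus ρ₁) (fst_tildeMinus ρ₂)⟩
    rintro ⟨u, hu⟩
    refine ⟨inlUnit u, fun d ↦ ?_⟩
    ext1
    · rw [fst_inlUnit_conj, fst_tildeMinus, fst_tildeMinus, fst_inlUnit_conj, hu]
    · rw [snd_inlUnit_conj, snd_tildeMinus, snd_tildeMinus, snd_inlUnit_conj, ← hu, mul_neg,
        neg_mul]
  exact ⟨hplus, hplus.symm.trans hminus, hplus', hplus'.symm.trans hminus'⟩
end

section
/- Assume char K ≠ 2 and X is a connected locally finite poset satisfying conditions (M) and (D). Let Φ₁ be an involution on D(X,K) of the form Φ₁ = Ψ_{θ₀} ∘ ρ̃_λ ∘ (s̃δ) with θ₀ a unit, λ an involution on X, and s ∈ {−1,1}, and suppose Φ₂ = Ψ_θ ∘ Φ₁ is also an involution on D(X,K), for a unit θ of D(X,K). Then Φ₁(θ) = (k₀δ, k₁δ)·θ for some k₀ ∈ {−1,1} and k₁ ∈ K. Moreover: (i) if s = 1, then k₁ = 0, so Φ₁(θ) = k₀θ; (ii) if s = −1, then there exists a unit γ of D(X,K) with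 Φ₂ = Ψ_γ ∘ Φ₁ and Φ₁(γ) = k₀γ. -/
open TrivSqZeroExt

variable (K X : Type*) [Field K] [PartialOrder X] [LocallyFiniteOrder X] [DecidableEq X]

/-- The anti-automorphism `ρ_λ` of the incidence algebra induced by an order
anti-automorphism `lam` of `X`: `ρ_λ(f)(x,y) = f(λ(y), λ(x))`. -/
def rhoLam (lam : X → X) (hlam : ∀ x y : X, x ≤ y ↔ lam y ≤ lam x)
    (f : IncidenceAlgebra K X) : IncidenceAlgebra K X :=
  ⟨fun x y => f (lam y) (lam x), fun x y hxy =>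
    IncidenceAlgebra.apply_eq_zero_of_not_le (fun h => hxy ((hlam x y).mpr h)) f⟩

/-- The anti-automorphism `ρ̃_λ` of `D(X,K)`: `(f,i) ↦ (ρ_λ(f), ρ_λ(i))`. -/
def rhoTilde (lam : X → X) (hlam : ∀ x y : X, x ≤ y ↔ lam y ≤ lam x)
    (d : TrivSqZeroExt (IncidenceAlgebra K X) (IncidenceAlgebra K X)) :
    TrivSqZeroExt (IncidenceAlgebra K X) (IncidenceAlgebra K X) :=
  inl (rhoLam K X lam hlam d.fst) + inr (rhoLam K X lam hlam d.snd)

/-- The automorphism `k̃δ` of `D(X,K)`: `(f,i) ↦ (f, k·i)`. -/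
def kTilde (k : K) (d : TrivSqZeroExt (IncidenceAlgebra K X) (IncidenceAlgebra K X)) :
    TrivSqZeroExt (IncidenceAlgebra K X) (IncidenceAlgebra K X) :=
  inl d.fst + inr (k • d.snd)

/-- Condition (M): every multiplicative automorphism of `I(X,K)` is inner. -/
def CondM : Prop :=
  ∀ σ : X → X → K, (∀ x y : X, x ≤ y → σ x y ≠ 0) →
    (∀ x y z : X, x ≤ y → y ≤ z → σ x y * σ y z = σ x z) →
    ∃ u : (IncidenceAlgebra K X)ˣ, ∀ (f : IncidenceAlgebra K X) (x y : X), x ≤ y →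
      (↑u * f * ↑u⁻¹ : IncidenceAlgebra K X) x y = σ x y * f x y

/-- Condition (D): every `K`-linear derivation of `I(X,K)` is inner. -/
def CondD : Prop :=
  ∀ Der : IncidenceAlgebra K X → IncidenceAlgebra K X,
    (∀ f g, Der (f + g) = Der f + Der g) →
    (∀ (k : K) (f : IncidenceAlgebra K X), Der (k • f) = k • Der f) →
    (∀ f g, Der (f * g) = Der f * g + f * Der g) →
    ∃ i : IncidenceAlgebra K X, ∀ f, Der f = f * i - i * f

/-- Connectedness of the poset `X`. -/
def PosetConnected : Prop :=
  ∀ x y : X, Relation.ReflTransGen (fun a b : X => a ≤ b ∨ b ≤ a) x y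

set_option linter.unusedSectionVars false

variable {K X}

section RhoLam

variable (lam : X → X) (hlam : ∀ x y : X, x ≤ y ↔ lam y ≤ lam x)

@[simp]
lemma rhoLam_apply (f : IncidenceAlgebra K X) (x y : X) :
    rhoLam K X lam hlam f x y = f (lam y) (lam x) := rfl

lemma rhoLam_add (f g : IncidenceAlgebra K X) :
    rhoLam K X lam hlam (f + g) = rhoLam K X lam hlam f + rhoLam K X lam hlam g := by
  ext x y
  simp

lemma rhoLam_smul (k : K) (f : IncidenceAlgebra K X) :
    rhoLam K X lam hlam (k • f) = k • rhoLam K X lam hlam f := by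
  ext x y
  simp

lemma rhoLam_one (hinvo : ∀ x : X, lam (lam x) = x) : rhoLam K X lam hlam 1 = 1 := by
  have hinj : Function.Injective lam := Function.Involutive.injective hinvo
  ext x y
  simp [IncidenceAlgebra.one_apply, hinj.eq_iff, eq_comm]

lemma rhoLam_mul (hinvo : ∀ x : X, lam (lam x) = x) (f g : IncidenceAlgebra K X) :
    rhoLam K X lam hlam (f * g) = rhoLam K X lam hlam g * rhoLam K X lam hlam f := by
  ext x y
  simp only [rhoLam_apply, IncidenceAlgebra.mul_apply]
  refine Finset.sum_nbij' lam lam ?_ ?_ (fun z _ => hinvo z) (fun z _ => hinvo z) ?_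
  · intro z hz
    rw [Finset.mem_Icc] at hz ⊢
    exact ⟨(hlam _ _).mpr (by rw [hinvo]; exact hz.2), (hlam _ _).mpr (by rw [hinvo]; exact hz.1)⟩
  · intro z hz
    rw [Finset.mem_Icc] at hz ⊢
    exact ⟨(hlam _ _).mp hz.2, (hlam _ _).mp hz.1⟩
  · intro z _
    rw [hinvo, mul_comm]

lemma rhoTilde_mul (hinvo : ∀ x : X, lam (lam x) = x)
    (d e : TrivSqZeroExt (IncidenceAlgebra K X) (IncidenceAlgebra K X)) :
    rhoTilde K X lam hlam (d * e) = rhoTilde K X lam hlam e * rhoTilde K X lam hlam d := by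
  ext1 <;> simp [rhoTilde, rhoLam_mul lam hlam hinvo, rhoLam_add, add_comm]

end RhoLam

lemma kTilde_mul (k : K) (d e : TrivSqZeroExt (IncidenceAlgebra K X) (IncidenceAlgebra K X)) :
    kTilde K X k (d * e) = kTilde K X k d * kTilde K X k e := by
  ext1 <;> simp [kTilde]

/-- The matrix unit `e_{xy}` of the incidence algebra. -/
def incidenceSingle (K : Type*) {X : Type*} [Field K] [PartialOrder X] [DecidableEq X]
    {x y : X} (hxy : x ≤ y) : IncidenceAlgebra K X :=
  ⟨fun a b => if a = x ∧ b = y then 1 else 0, fun a b hab =>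
    if_neg fun h => hab (by rw [h.1, h.2]; exact hxy)⟩

lemma incidenceSingle_apply {x y : X} (hxy : x ≤ y) (a b : X) :
    incidenceSingle K hxy a b = if a = x ∧ b = y then 1 else 0 := rfl

lemma apply_eq_zero_of_commute_all {f : IncidenceAlgebra K X} (hf : ∀ g, f * g = g * f)
    {x y : X} (hxy : x ≠ y) : f x y = 0 := by
  by_cases hle : x ≤ y
  · have h := congrArg (fun g : IncidenceAlgebra K X => g x y) (hf (incidenceSingle K (le_refl x)))
    simpa [IncidenceAlgebra.mul_apply, incidenceSingle_apply, hxy.symm, hle]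
      using h.symm
  · exact IncidenceAlgebra.apply_eq_zero_of_not_le hle f

lemma apply_self_eq_of_commute_all {f : IncidenceAlgebra K X} (hf : ∀ g, f * g = g * f)
    {x y : X} (hxy : x ≤ y) : f x x = f y y := by
  have h := congrArg (fun g : IncidenceAlgebra K X => g x y) (hf (incidenceSingle K hxy))
  simpa [IncidenceAlgebra.mul_apply, incidenceSingle_apply, hxy] using h

lemma exists_eq_smul_one_of_commute_all (hconn : PosetConnected X) {f : IncidenceAlgebra K X}
    (hf : ∀ g, f * g = g * f) : ∃ k : K, f = k • (1 : IncidenceAlgebra K X) := by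
  rcases isEmpty_or_nonempty X with _ | ⟨⟨x₀⟩⟩
  · exact ⟨0, by ext x; exact isEmptyElim x⟩
  · have hdiag : ∀ x, f x x = f x₀ x₀ := by
      intro x
      induction hconn x₀ x with
      | refl => rfl
      | tail _ hab ih =>
        rcases hab with h | h
        · rw [← apply_self_eq_of_commute_all hf h, ih]
        · rw [apply_self_eq_of_commute_all hf h, ih]
    refine ⟨f x₀ x₀, ?_⟩
    ext x y
    rcases eq_or_ne x y with rfl | hxy
    · simp [hdiag]
    · simp [apply_eq_zero_of_commute_all hf hxy, IncidenceAlgebra.one_apply, hxy]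

/-- The element `(kδ, mδ)` of `D(X,K)`. -/
def dualScalar (X : Type*) {K : Type*} [Field K] [PartialOrder X] [DecidableEq X] (k m : K) :
    TrivSqZeroExt (IncidenceAlgebra K X) (IncidenceAlgebra K X) :=
  inl (k • (1 : IncidenceAlgebra K X)) + inr (m • (1 : IncidenceAlgebra K X))

lemma dualScalar_mul_comm (k m : K)
    (d : TrivSqZeroExt (IncidenceAlgebra K X) (IncidenceAlgebra K X)) :
    dualScalar X k m * d = d * dualScalar X k m := by
  ext1 <;> simp [dualScalar, add_comm]

lemma dualScalar_mul_dualScalar (k m k' m' : K) :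
    dualScalar X k m * dualScalar X k' m' = dualScalar X (k * k') (k * m' + m * k') := by
  ext1 <;> simp [dualScalar, smul_smul, add_smul, mul_comm]

lemma dualScalar_one_zero : dualScalar X (1 : K) 0 = 1 := by
  ext1 <;> simp [dualScalar]

lemma dualScalar_zero_mul (k : K)
    (d : TrivSqZeroExt (IncidenceAlgebra K X) (IncidenceAlgebra K X)) :
    dualScalar X k 0 * d = k • d := by
  ext1 <;> simp [dualScalar]

lemma dualScalar_injective [Nonempty X] {k m k' m' : K}
    (h : dualScalar X k m = dualScalar X k' m') : k = k' ∧ m = m' := by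
  obtain ⟨x⟩ := ‹Nonempty X›
  have h1 := congrArg (fun d => d.fst x x) h
  have h2 := congrArg (fun d => d.snd x x) h
  simp only [dualScalar] at h1 h2
  constructor
  · simpa using h1
  · simpa using h2

lemma exists_eq_dualScalar_of_commute_all (hconn : PosetConnected X)
    {z : TrivSqZeroExt (IncidenceAlgebra K X) (IncidenceAlgebra K X)}
    (hz : ∀ d, z * d = d * z) : ∃ k m : K, z = dualScalar X k m := by
  obtain ⟨k, hk⟩ := exists_eq_smul_one_of_commute_all (f := z.fst) hconn fun g => by
    simpa using congrArg TrivSqZeroExt.fst (hz (inl g))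
  obtain ⟨m, hm⟩ := exists_eq_smul_one_of_commute_all (f := z.snd) hconn fun g => by
    simpa using congrArg TrivSqZeroExt.snd (hz (inl g))
  refine ⟨k, m, ?_⟩
  ext1 <;> simp [dualScalar, hk, hm]

lemma rhoTilde_kTilde_dualScalar (lam : X → X) (hlam : ∀ x y : X, x ≤ y ↔ lam y ≤ lam x)
    (hinvo : ∀ x : X, lam (lam x) = x) (s k m : K) :
    rhoTilde K X lam hlam (kTilde K X s (dualScalar X k m)) = dualScalar X k (s * m) := by
  ext1 <;> simp [rhoTilde, kTilde, dualScalar, rhoLam_smul, rhoLam_one lam hlam hinvo, smul_smul]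

/-- If `φ` and `Ψ_u ∘ φ` are both involutive, with `φ` anti-multiplicative, then `φ(u)u⁻¹` is
central. -/
lemma apply_unit_mul_inv_commute_all {R : Type*} [Monoid R] {φ : R → R} {u : Rˣ}
    (hone : φ 1 = 1) (hmul : ∀ a b, φ (a * b) = φ b * φ a) (hinvo : ∀ a, φ (φ a) = a)
    (hinvo' : ∀ a, ↑u * φ (↑u * φ a * ↑u⁻¹) * ↑u⁻¹ = a) (a : R) :
    φ u * ↑u⁻¹ * a = a * (φ u * ↑u⁻¹) := by
  have hu : φ u * φ ↑u⁻¹ = 1 := by rw [← hmul, Units.inv_mul, hone]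
  have key : ↑u * φ ↑u⁻¹ * a * (φ u * ↑u⁻¹) = a := by
    conv_rhs => rw [← hinvo' a]
    simp only [hmul, hinvo, mul_assoc]
  calc φ u * ↑u⁻¹ * a = φ u * ↑u⁻¹ * (↑u * φ ↑u⁻¹ * a * (φ u * ↑u⁻¹)) := by rw [key]
    _ = φ u * (↑u⁻¹ * ↑u) * φ ↑u⁻¹ * a * (φ u * ↑u⁻¹) := by simp only [mul_assoc]
    _ = a * (φ u * ↑u⁻¹) := by rw [Units.inv_mul, mul_one, hu, one_mul]

variable (K X)

/-- Assume `char K ≠ 2` and `X` is a connected locally finite poset satisfying conditions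
(M) and (D).  Let `Φ₁ = Ψ_{θ₀} ∘ ρ̃_λ ∘ s̃δ` be an involution on `D(X,K)` with `θ₀` a
unit, `λ` an involution on `X` and `s ∈ {-1,1}`, and suppose `Φ₂ = Ψ_θ ∘ Φ₁` is also
an involution, for a unit `θ`.  Then `Φ₁(θ) = (k₀δ, k₁δ)·θ` for some `k₀ ∈ {-1,1}` and
`k₁ ∈ K`; moreover (i) if `s = 1` then `k₁ = 0`, so `Φ₁(θ) = k₀·θ`; (ii) if `s = -1`
then there is a unit `γ` with `Φ₂ = Ψ_γ ∘ Φ₁` and `Φ₁(γ) = k₀·γ`. -/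
theorem symmetric_or_skew_unit_of_involutions
    (K X : Type*) [Field K] [PartialOrder X] [LocallyFiniteOrder X] [DecidableEq X]
    (hchar : (2 : K) ≠ 0)
    (hconn : PosetConnected X) (hM : CondM K X) (hD : CondD K X)
    (Φ₁ Φ₂ : TrivSqZeroExt (IncidenceAlgebra K X) (IncidenceAlgebra K X) →
             TrivSqZeroExt (IncidenceAlgebra K X) (IncidenceAlgebra K X))
    (θ₀ θ : (TrivSqZeroExt (IncidenceAlgebra K X) (IncidenceAlgebra K X))ˣ)
    (lam : X → X)
    (hlam : ∀ x y : X, x ≤ y ↔ lam y ≤ lam x)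
    (hlaminvo : ∀ x : X, lam (lam x) = x)
    (s : K) (hs : s = 1 ∨ s = -1)
    (hΦ₁ : ∀ d, Φ₁ d = ↑θ₀ * rhoTilde K X lam hlam (kTilde K X s d) * ↑θ₀⁻¹)
    (hΦ₁invo : ∀ d, Φ₁ (Φ₁ d) = d)
    (hΦ₂ : ∀ d, Φ₂ d = ↑θ * Φ₁ d * ↑θ⁻¹)
    (hΦ₂invo : ∀ d, Φ₂ (Φ₂ d) = d) :
    ∃ k₀ k₁ : K, (k₀ = 1 ∨ k₀ = -1) ∧
      Φ₁ ↑θ = (inl (k₀ • (1 : IncidenceAlgebra K X)) +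
               inr (k₁ • (1 : IncidenceAlgebra K X))) * (↑θ : TrivSqZeroExt (IncidenceAlgebra K X) (IncidenceAlgebra K X)) ∧
      (s = 1 → k₁ = 0 ∧ Φ₁ ↑θ = k₀ • (↑θ : TrivSqZeroExt (IncidenceAlgebra K X) (IncidenceAlgebra K X))) ∧
      (s = -1 → ∃ γ : (TrivSqZeroExt (IncidenceAlgebra K X) (IncidenceAlgebra K X))ˣ,
        (∀ d, Φ₂ d = ↑γ * Φ₁ d * ↑γ⁻¹) ∧
        Φ₁ ↑γ = k₀ • (↑γ : TrivSqZeroExt (IncidenceAlgebra K X) (IncidenceAlgebra K X))) := by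
  have hρmul : ∀ a b, Φ₁ (a * b) = Φ₁ b * Φ₁ a := by
    intro a b
    simp only [hΦ₁, kTilde_mul, rhoTilde_mul lam hlam hlaminvo, mul_assoc,
      Units.inv_mul_cancel_left]
  have hscalar : ∀ k m : K, Φ₁ (dualScalar X k m) = dualScalar X k (s * m) := by
    intro k m
    rw [hΦ₁, rhoTilde_kTilde_dualScalar lam hlam hlaminvo, ← dualScalar_mul_comm, mul_assoc,
      Units.mul_inv, mul_one]
  have hone : Φ₁ 1 = 1 := by
    rw [← dualScalar_one_zero, hscalar, mul_zero]
  rcases isEmpty_or_nonempty X with hX | hX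
  · have : Subsingleton (IncidenceAlgebra K X) := ⟨fun f g => by ext x; exact isEmptyElim x⟩
    have hsub : ∀ a b : TrivSqZeroExt (IncidenceAlgebra K X) (IncidenceAlgebra K X), a = b :=
      fun a b => TrivSqZeroExt.ext (Subsingleton.elim _ _) (Subsingleton.elim _ _)
    exact ⟨1, 0, Or.inl rfl, hsub _ _, fun _ => ⟨rfl, hsub _ _⟩,
      fun _ => ⟨1, fun _ => hsub _ _, hsub _ _⟩⟩
  obtain ⟨k₀, k₁, hz⟩ := exists_eq_dualScalar_of_commute_all hconn
    (apply_unit_mul_inv_commute_all (u := θ) hone hρmul hΦ₁invo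
      fun a => by rw [← hΦ₂ a, ← hΦ₂, hΦ₂invo])
  have hθ : Φ₁ ↑θ = dualScalar X k₀ k₁ * ↑θ := by
    rw [← hz, mul_assoc, Units.inv_mul, mul_one]
  have hnorm : dualScalar X (k₀ * k₀) (k₀ * (s * k₁) + k₁ * k₀) = dualScalar X (1 : K) 0 := by
    rw [← dualScalar_mul_dualScalar, dualScalar_one_zero, ← θ.isUnit.mul_left_inj, one_mul]
    conv_rhs => rw [← hΦ₁invo ↑θ, hθ, hρmul, hscalar, hθ]
    rw [mul_assoc, dualScalar_mul_comm k₀ (s * k₁), mul_assoc]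
  obtain ⟨hk₀, hk₁⟩ := dualScalar_injective hnorm
  refine ⟨k₀, k₁, mul_self_eq_one_iff.mp hk₀, hθ, ?_, ?_⟩
  · rintro rfl
    have hk₀' : k₀ ≠ 0 := fun h => by simp [h] at hk₀
    have : k₁ = 0 := by
      have h : 2 * k₀ * k₁ = 0 := by linear_combination hk₁
      simpa [hchar, hk₀'] using h
    exact ⟨this, by rw [hθ, this, dualScalar_zero_mul]⟩
  · rintro rfl
    have hhalf : (2 : K) * 2⁻¹ = 1 := mul_inv_cancel₀ hchar
    let m : K := 2⁻¹ * (k₀ * k₁)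
    let c : (TrivSqZeroExt (IncidenceAlgebra K X) (IncidenceAlgebra K X))ˣ :=
      ⟨dualScalar X 1 m, dualScalar X 1 (-m),
        by rw [dualScalar_mul_dualScalar, ← dualScalar_one_zero]; congr 1 <;> ring,
        by rw [dualScalar_mul_dualScalar, ← dualScalar_one_zero]; congr 1 <;> ring⟩
    have hc : (c : TrivSqZeroExt (IncidenceAlgebra K X) (IncidenceAlgebra K X)) =
      dualScalar X 1 m := rfl
    refine ⟨c * θ, fun d => ?_, ?_⟩
    · have hcomm := dualScalar_mul_comm 1 m (Φ₂ d)
      rw [← hc] at hcomm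
      calc Φ₂ d = ↑c * Φ₂ d * ↑c⁻¹ := by rw [hcomm, Units.mul_inv_cancel_right]
        _ = _ := by simp only [hΦ₂, mul_inv_rev, Units.val_mul, mul_assoc]
    · rw [Units.val_mul, hρmul, hc, hscalar, hθ, ← dualScalar_mul_comm, ← mul_assoc,
        ← dualScalar_zero_mul k₀, ← mul_assoc (dualScalar X k₀ 0), dualScalar_mul_dualScalar,
        dualScalar_mul_dualScalar]
      congr 2
      · ring
      · simp only [m]
        linear_combination (-k₁ * k₀ ^ 2) * hhalf - k₁ * hk₀
end

section
/- Let K be a field with char K ≠ 2, X a locally finite poset, λ an involution on X having at least one fixed point, and k ∈ {−1,1}. Then there is no unit θ of D(X,K) such that (ρ̃_λ ∘ (k̃δ))(θ) = −θ. -/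
open TrivSqZeroExt

variable (K X : Type*) [Field K] [PartialOrder X] [LocallyFiniteOrder X] [DecidableEq X]

/-- Evaluating at a point of the diagonal is multiplicative on the incidence algebra. -/
theorem IncidenceAlgebra.mul_apply_self {R P : Type*} [NonUnitalNonAssocSemiring R]
    [PartialOrder P] [LocallyFiniteOrder P] (f g : IncidenceAlgebra R P) (x : P) :
    (f * g) x x = f x x * g x x := by
  simp [IncidenceAlgebra.mul_apply]

/-- Let `K` be a field with `char K ≠ 2`, `X` a locally finite poset, `λ` an involution
on `X` having at least one fixed point, and `k ∈ {-1,1}`.  Then there is no unit `θ` of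
`D(X,K)` such that `(ρ̃_λ ∘ k̃δ)(θ) = -θ`. -/
theorem no_skew_unit_of_fixed_point
    (K X : Type*) [Field K] [PartialOrder X] [LocallyFiniteOrder X] [DecidableEq X]
    (hchar : (2 : K) ≠ 0)
    (lam : X → X)
    (hlam : ∀ x y : X, x ≤ y ↔ lam y ≤ lam x)
    (hlaminvo : ∀ x : X, lam (lam x) = x)
    (hfix : ∃ x : X, lam x = x)
    (k : K) (hk : k = 1 ∨ k = -1) :
    ¬ ∃ θ : (TrivSqZeroExt (IncidenceAlgebra K X) (IncidenceAlgebra K X))ˣ,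
        rhoTilde K X lam hlam (kTilde K X k ↑θ) =
          -(↑θ : TrivSqZeroExt (IncidenceAlgebra K X) (IncidenceAlgebra K X)) := by
  rintro ⟨θ, hθ⟩
  obtain ⟨x, hx⟩ := hfix
  have hneg := congrArg (fun d => d.fst x x) hθ
  simp only [rhoTilde, kTilde, rhoLam, fst_add, fst_inl, fst_inr, add_zero, fst_neg,
    IncidenceAlgebra.neg_apply, IncidenceAlgebra.coe_mk, hx] at hneg
  have hzero : θ.val.fst x x = 0 := by
    refine (mul_eq_zero.mp ?_).resolve_left hchar
    linear_combination hneg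
  have hone := congrArg (fun d => d.fst x x) θ.mul_inv
  simp only [fst_mul, fst_one, IncidenceAlgebra.mul_apply_self, IncidenceAlgebra.one_apply, if_true,
    hzero, zero_mul, zero_ne_one] at hone
end
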